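/- arXiv:2306.00843 — 4 statements merged into one kernel-verified Lean document; each statement's English description precedes it below -/
import Mathlib

section
/- Let Tᵃ be the binary tree of depth 2, i.e., the tree on vertices {1,...,7} with edges {12, 13, 24, 25, 36, 37}. Then the minimum size of a family of paths in Tᵃ that separates and covers E(Tᵃ) equals 4. -/
open SimpleGraph
open scoped Classical

universe u

variable {V : Type u}

/-- A path in a graph `G`, recorded with its two endpoints. -/
def PathIn {V : Type u} (G : SimpleGraph V) : Type u :=
  Σ a b : V, {p : G.Walk a b // p.IsPath}

/-- The path `P` contains the vertex `x`. -/
def PathIn.vmem {G : SimpleGraph V} (x : V) (P : PathIn G) : Prop :=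
  x ∈ P.2.2.1.support

/-- The path `P` contains the edge `e`. -/
def PathIn.emem {G : SimpleGraph V} (e : Sym2 V) (P : PathIn G) : Prop :=
  e ∈ P.2.2.1.edges

/-- The path `P` contains the element `s` (a vertex or an edge). -/
def ElemMem (G : SimpleGraph V) (s : V ⊕ Sym2 V) (P : PathIn G) : Prop :=
  Sum.elim (fun x => PathIn.vmem x P) (fun e => PathIn.emem e P) s

/-- `F` separates the set `S` of elements (vertices and/or edges) of `G`. -/
def Separates (G : SimpleGraph V) (S : Set (V ⊕ Sym2 V)) (F : Set (PathIn G)) : Prop :=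
  ∀ s ∈ S, ∀ t ∈ S, s ≠ t → ∃ P ∈ F,
    (ElemMem G s P ∧ ¬ ElemMem G t P) ∨ (¬ ElemMem G s P ∧ ElemMem G t P)

/-- `F` covers the set `S` of elements of `G`. -/
def Covers (G : SimpleGraph V) (S : Set (V ⊕ Sym2 V)) (F : Set (PathIn G)) : Prop :=
  ∀ s ∈ S, ∃ P ∈ F, ElemMem G s P

/-- `F` separates the edges of `G`. -/
def EdgeSep (G : SimpleGraph V) (F : Set (PathIn G)) : Prop :=
  ∀ e ∈ G.edgeSet, ∀ f ∈ G.edgeSet, e ≠ f → ∃ P ∈ F,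
    (PathIn.emem e P ∧ ¬ PathIn.emem f P) ∨ (¬ PathIn.emem e P ∧ PathIn.emem f P)

/-- `F` covers the edges of `G`. -/
def EdgeCover (G : SimpleGraph V) (F : Set (PathIn G)) : Prop :=
  ∀ e ∈ G.edgeSet, ∃ P ∈ F, PathIn.emem e P

/-- `F` separates the vertices of `G`. -/
def VertexSep (G : SimpleGraph V) (F : Set (PathIn G)) : Prop :=
  ∀ x y : V, x ≠ y → ∃ P ∈ F,
    (PathIn.vmem x P ∧ ¬ PathIn.vmem y P) ∨ (¬ PathIn.vmem x P ∧ PathIn.vmem y P)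

/-- `F` covers the vertices of `G`. -/
def VertexCover (G : SimpleGraph V) (F : Set (PathIn G)) : Prop :=
  ∀ x : V, ∃ P ∈ F, PathIn.vmem x P

/-- The number of leaves of `G`. -/
noncomputable def leafCount (G : SimpleGraph V) [Fintype V] : ℕ :=
  Nat.card {x : V | G.degree x = 1}

/-- The number of degree-two vertices of `G`. -/
noncomputable def deg2Count (G : SimpleGraph V) [Fintype V] : ℕ :=
  Nat.card {x : V | G.degree x = 2}

/-- The set of interior edges: edges with neither endpoint a leaf. -/
noncomputable def interiorEdgeSet (G : SimpleGraph V) [Fintype V] : Set (Sym2 V) :=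
  {e : Sym2 V | e ∈ G.edgeSet ∧ ∀ x ∈ e, G.degree x ≠ 1}

/-- The binary tree of depth 2, on 7 vertices. -/
def Ta : SimpleGraph (Fin 7) :=
  SimpleGraph.fromEdgeSet {s(0,1), s(0,2), s(1,3), s(1,4), s(2,5), s(2,6)}

/-- Bitmask of the edges between a vertex and the root. -/
def anc : Fin 7 → ℕ := ![0,1,2,5,9,18,34]

/-- The edges of the tree. -/
def edg : Fin 6 → Sym2 (Fin 7) := ![s(0,1), s(0,2), s(1,3), s(1,4), s(2,5), s(2,6)]

lemma Ta_adj (a c : Fin 7) : Ta.Adj a c ↔ ∃ i, edg i = s(a,c) := by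
  simp only [Ta, SimpleGraph.fromEdgeSet_adj, Set.mem_insert_iff, Set.mem_singleton_iff]
  revert a c
  decide +kernel

lemma edg_step : ∀ (a c : Fin 7), (∃ i, edg i = s(a,c)) → ∀ i : Fin 6,
    (edg i = s(a,c) ↔ ((anc a).testBit i ≠ (anc c).testBit i)) := by
  decide +kernel

lemma walk_edge {a b : Fin 7} (p : Ta.Walk a b) (hp : p.IsPath) (i : Fin 6) :
    edg i ∈ p.edges ↔ (anc a).testBit i ≠ (anc b).testBit i := by
  induction p with
  | nil => simp
  | @cons a c b h p ih =>
    rw [SimpleGraph.Walk.cons_isPath_iff] at hp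
    have ih := ih hp.1
    have hs := edg_step a c ((Ta_adj a c).1 h) i
    have hn : edg i = s(a,c) → edg i ∉ p.edges := by
      intro e he
      rw [e] at he
      exact hp.2 (p.fst_mem_support_of_mem_edges he)
    rw [SimpleGraph.Walk.edges_cons, List.mem_cons]
    revert ih hs hn
    generalize (anc a).testBit i = x
    generalize (anc b).testBit i = y
    generalize (anc c).testBit i = z
    intro ih hs hn
    by_cases h1 : edg i = s(a,c) <;> by_cases h2 : edg i ∈ p.edges <;>
      cases x <;> cases y <;> cases z <;> simp_all

/-- Edge bitmask of a path. -/
def sig (P : PathIn Ta) : ℕ := anc P.1 ^^^ anc P.2.1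

lemma emem_iff (P : PathIn Ta) (i : Fin 6) : PathIn.emem (edg i) P ↔ (sig P).testBit i = true := by
  unfold PathIn.emem sig
  rw [walk_edge _ P.2.2.2 i, Nat.testBit_xor]
  simp

lemma edge_iff (e : Sym2 (Fin 7)) : e ∈ Ta.edgeSet ↔ ∃ i, edg i = e := by
  induction e with
  | _ a c => rw [SimpleGraph.mem_edgeSet, Ta_adj]

lemma edg_inj : ∀ i j, edg i = edg j → i = j := by decide +kernel

lemma sep_iff (F : Set (PathIn Ta)) : EdgeSep Ta F ↔ ∀ i j : Fin 6, i ≠ j → ∃ P ∈ F,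
    (sig P).testBit i ≠ (sig P).testBit j := by
  unfold EdgeSep
  constructor
  · intro h i j hij
    obtain ⟨P, hP, h⟩ := h _ ((edge_iff _).2 ⟨i, rfl⟩) _ ((edge_iff _).2 ⟨j, rfl⟩)
      (fun e => hij (edg_inj _ _ e))
    refine ⟨P, hP, ?_⟩
    rw [emem_iff, emem_iff] at h
    grind
  · intro h e he f hf hef
    obtain ⟨i, rfl⟩ := (edge_iff _).1 he
    obtain ⟨j, rfl⟩ := (edge_iff _).1 hf
    obtain ⟨P, hP, h⟩ := h i j (fun e => hef (by rw [e]))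
    refine ⟨P, hP, ?_⟩
    rw [emem_iff, emem_iff]
    grind

lemma cover_iff (F : Set (PathIn Ta)) : EdgeCover Ta F ↔ ∀ i : Fin 6, ∃ P ∈ F,
    (sig P).testBit i = true := by
  unfold EdgeCover
  constructor
  · intro h i
    obtain ⟨P, hP, h⟩ := h _ ((edge_iff _).2 ⟨i, rfl⟩)
    exact ⟨P, hP, (emem_iff _ _).1 h⟩
  · intro h e he
    obtain ⟨i, rfl⟩ := (edge_iff _).1 he
    obtain ⟨P, hP, h⟩ := h i
    exact ⟨P, hP, (emem_iff _ _).2 h⟩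

/-- All edge bitmasks of paths. -/
def masks : List ℕ := [0, 1, 2, 3, 4, 5, 7, 8, 9, 11, 12, 16, 18, 19, 23, 27, 32, 34, 35, 39, 43, 48]

lemma sig_mem (P : PathIn Ta) : sig P ∈ masks := by
  have : ∀ a b : Fin 7, anc a ^^^ anc b ∈ masks := by decide +kernel
  exact this _ _

lemma no_three : ∀ x ∈ masks, ∀ y ∈ masks, ∀ z ∈ masks,
    ¬ ((∀ i : Fin 6, (x.testBit i || y.testBit i || z.testBit i) = true) ∧
      ∀ i j : Fin 6, i < j → ((x.testBit i != x.testBit j) || (y.testBit i != y.testBit j) ||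
        (z.testBit i != z.testBit j)) = true) := by
  decide +kernel

lemma exists_path (a b : Fin 7) : ∃ P : PathIn Ta, P.1 = a ∧ P.2.1 = b := by
  have r1 : Ta.Reachable 0 1 := SimpleGraph.Adj.reachable ((Ta_adj _ _).2 ⟨0, rfl⟩)
  have r2 : Ta.Reachable 0 2 := SimpleGraph.Adj.reachable ((Ta_adj _ _).2 ⟨1, rfl⟩)
  have r3 : Ta.Reachable 1 3 := SimpleGraph.Adj.reachable ((Ta_adj _ _).2 ⟨2, rfl⟩)
  have r4 : Ta.Reachable 1 4 := SimpleGraph.Adj.reachable ((Ta_adj _ _).2 ⟨3, rfl⟩)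
  have r5 : Ta.Reachable 2 5 := SimpleGraph.Adj.reachable ((Ta_adj _ _).2 ⟨4, rfl⟩)
  have r6 : Ta.Reachable 2 6 := SimpleGraph.Adj.reachable ((Ta_adj _ _).2 ⟨5, rfl⟩)
  have h : ∀ v, Ta.Reachable 0 v := by
    intro v
    fin_cases v
    · exact SimpleGraph.Reachable.refl _
    · exact r1
    · exact r2
    · exact r1.trans r3
    · exact r1.trans r4
    · exact r2.trans r5
    · exact r2.trans r6
  obtain ⟨p, hp⟩ := ((h a).symm.trans (h b)).exists_isPath
  exact ⟨⟨a, b, p, hp⟩, rfl, rfl⟩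

/-- A path with prescribed endpoints. -/
noncomputable def pth (a b : Fin 7) : PathIn Ta := (exists_path a b).choose

lemma pth_sig (a b : Fin 7) : sig (pth a b) = anc a ^^^ anc b := by
  unfold sig pth
  rw [(exists_path a b).choose_spec.2, (exists_path a b).choose_spec.1]

/-- First endpoints of the optimal family. -/
def fa : Fin 4 → Fin 7 := ![0, 0, 3, 3]

/-- Second endpoints of the optimal family. -/
def fb : Fin 4 → Fin 7 := ![1, 5, 4, 6]

theorem stmt4 :
    IsLeast {n : ℕ | ∃ F : Set (PathIn Ta),
      F.Finite ∧ EdgeSep Ta F ∧ EdgeCover Ta F ∧ F.ncard = n} 4 := by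
  constructor
  · let g : Fin 4 → PathIn Ta := fun k => pth (fa k) (fb k)
    have hg : ∀ k, sig (g k) = anc (fa k) ^^^ anc (fb k) := fun k => pth_sig _ _
    have hinj : Function.Injective g := by
      have h : ∀ k l : Fin 4, anc (fa k) ^^^ anc (fb k) = anc (fa l) ^^^ anc (fb l) → k = l := by
        decide +kernel
      intro k l e
      apply h
      rw [← hg, ← hg, e]
    refine ⟨Set.range g, Set.finite_range g, ?_, ?_, ?_⟩
    · rw [sep_iff]
      simp only [Set.exists_range_iff, hg]
      decide +kernel
    · rw [cover_iff]
      simp only [Set.exists_range_iff, hg]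
      decide +kernel
    · rw [← Set.image_univ, Set.ncard_image_of_injective _ hinj]
      simp
  · rintro n ⟨F, hF, hs, hc, rfl⟩
    by_contra hlt
    rw [sep_iff] at hs
    rw [cover_iff] at hc
    obtain ⟨P0, hP0, -⟩ := hc 0
    have hcard : hF.toFinset.card ≤ 3 := by
      rw [← Set.ncard_eq_toFinset_card F hF]; omega
    have hlen : hF.toFinset.toList.length ≤ 3 := by simpa using hcard
    have key : ∃ x y z : PathIn Ta, ∀ P ∈ F, P = x ∨ P = y ∨ P = z := by
      have hm : ∀ P ∈ F, P ∈ hF.toFinset.toList := fun P hP => by simpa using hP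
      revert hlen hm
      generalize hF.toFinset.toList = l
      intro hlen hm
      match l, hlen, hm with
      | [], _, hm => exact ⟨P0, P0, P0, fun P hP => by simpa using hm P hP⟩
      | [x], _, hm => exact ⟨x, x, x, fun P hP => by simpa using hm P hP⟩
      | [x, y], _, hm => exact ⟨x, y, y, fun P hP => by simpa using hm P hP⟩
      | [x, y, z], _, hm => exact ⟨x, y, z, fun P hP => by simpa using hm P hP⟩
    obtain ⟨x, y, z, key⟩ := key
    refine no_three _ (sig_mem x) _ (sig_mem y) _ (sig_mem z) ⟨?_, ?_⟩
    · intro i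
      obtain ⟨P, hP, h⟩ := hc i
      rcases key P hP with rfl | rfl | rfl <;> simp [h]
    · intro i j hij
      obtain ⟨P, hP, h⟩ := hs i j hij.ne
      rw [← bne_iff_ne] at h
      rcases key P hP with rfl | rfl | rfl <;> rw [h] <;> simp
end

section
/- Let T be a tree with h₁(T) ≤ h₂(T), where h₁ is the number of leaves and h₂ the number of degree-2 vertices. Then there exists a family of paths of size at most ⌈(h₁(T)+h₂(T))/2⌉ that separates and covers E(T). -/
open SimpleGraph
open scoped Classical

universe u

variable {V : Type u}

def SB {V : Type*} (le : V → V → Prop) (r : V) (x y : V) : Prop :=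
  ∃ v, v ≠ r ∧ le v x ∧ le v y

theorem SB.trans' {V : Type*} {le : V → V → Prop} {r : V}
    (htr : ∀ x y z, le x y → le y z → le x z)
    (hch : ∀ v v' x, le v x → le v' x → le v v' ∨ le v' v) {x y z : V}
    (h1 : SB le r x y) (h2 : SB le r y z) : SB le r x z := by
  obtain ⟨v, hv, a, b⟩ := h1
  obtain ⟨w, hw, c, d⟩ := h2
  rcases hch _ _ _ b c with h | h
  · exact ⟨v, hv, a, htr _ _ _ h d⟩
  · exact ⟨w, hw, htr _ _ _ h a, d⟩

theorem SB.symm' {V : Type*} {le : V → V → Prop} {r : V} {x y : V}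
    (h1 : SB le r x y) : SB le r y x := by
  obtain ⟨v, hv, a, b⟩ := h1
  exact ⟨v, hv, b, a⟩

theorem step1 {V : Type*} (le : V → V → Prop) (r : V)
    (htr : ∀ x y z, le x y → le y z → le x z)
    (hch : ∀ v v' x, le v x → le v' x → le v v' ∨ le v' v)
    (k : ℕ) (f g : Fin k → V)
    (P4 : ∀ v, v ≠ r → ∃ c, c ≠ r ∧ le c v ∧ (∀ w, w ≠ r → le w c → w = c) ∧
      (∑ i, if le c (f i) then 1 else 0) + (∑ i, if le c (g i) then 1 else 0) ≤ k) :
    ∃ π : Equiv.Perm (Fin k), ∀ i, ¬ SB le r (f i) (g (π i)) := by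
  obtain ⟨π, -, hmin⟩ := Finset.exists_min_image (Finset.univ : Finset (Equiv.Perm (Fin k)))
    (fun π => (Finset.univ.filter (fun i => SB le r (f i) (g (π i)))).card) ⟨1, Finset.mem_univ _⟩
  refine ⟨π, fun i hi => ?_⟩
  obtain ⟨v, hv, hvf, hvg⟩ := hi
  obtain ⟨c, hc, hcv, hcm, hcount⟩ := P4 v hv
  have hcf := htr _ _ _ hcv hvf
  have hcg := htr _ _ _ hcv hvg
  have hj : ∃ j, ¬ le c (f j) ∧ ¬ le c (g (π j)) := by
    by_contra hcon
    push Not at hcon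
    rw [← Equiv.sum_comp π (fun i => if le c (g i) then 1 else 0), ← Finset.sum_add_distrib] at hcount
    have : ∑ j : Fin k, 1 < ∑ j, ((if le c (f j) then 1 else 0) + if le c (g (π j)) then 1 else 0) := by
      apply Finset.sum_lt_sum
      · intro j _
        by_cases h : le c (f j)
        · simp [h]
        · simp [hcon j h]
      · exact ⟨i, Finset.mem_univ _, by simp [hcf, hcg]⟩
    simp only [Finset.sum_const, Finset.card_univ, Fintype.card_fin, smul_eq_mul, mul_one] at this
    omega
  obtain ⟨j, hjf, hjg⟩ := hj
  have key : ∀ x y, le c x → ¬ le c y → ¬ SB le r x y := by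
    rintro x y h1 h2 ⟨w, hw, hx, hy⟩
    rcases hch _ _ _ h1 hx with h | h
    · exact h2 (htr _ _ _ h hy)
    · exact h2 (hcm w hw h ▸ hy)
  have hij : i ≠ j := by rintro rfl; exact hjf hcf
  have := hmin (π * Equiv.swap i j) (Finset.mem_univ _)
  refine absurd this (not_le.mpr (Finset.card_lt_card ?_))
  rw [Finset.ssubset_iff_of_subset]
  · refine ⟨i, by simp only [Finset.mem_filter_univ]; exact ⟨v, hv, hvf, hvg⟩, ?_⟩
    simp only [Finset.mem_filter_univ]
    rw [Equiv.Perm.mul_apply, Equiv.swap_apply_left]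
    exact key _ _ hcf hjg
  · intro l
    simp only [Finset.mem_filter_univ]
    rw [Equiv.Perm.mul_apply]
    intro hl
    by_cases h1 : l = i
    · subst h1; exact ⟨v, hv, hvf, hvg⟩
    by_cases h2 : l = j
    · subst h2
      rw [Equiv.swap_apply_right] at hl
      exact absurd hl.symm' (key _ _ hcg hjf)
    · rwa [Equiv.swap_apply_of_ne_of_ne h1 h2] at hl

def Bad {V : Type*} (le : V → V → Prop) (r : V) {k : ℕ} (f g : Fin k → V)
    (π : Equiv.Perm (Fin k)) (a d : V) : Prop :=
  a ≠ r ∧ d ≠ r ∧ a ≠ d ∧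
    ∀ i, (le a (f i) ∨ le a (g (π i))) ↔ (le d (f i) ∨ le d (g (π i)))

theorem Bad.symm' {V : Type*} {le : V → V → Prop} {r : V} {k : ℕ} {f g : Fin k → V}
    {π : Equiv.Perm (Fin k)} {a d : V} (h : Bad le r f g π a d) : Bad le r f g π d a :=
  ⟨h.2.1, h.1, h.2.2.1.symm, fun i => (h.2.2.2 i).symm⟩

/-- structure of bad pairs -/
theorem Bad.struct {V : Type*} {le : V → V → Prop} {r : V}
    (htr : ∀ x y z, le x y → le y z → le x z)
    (hch : ∀ v v' x, le v x → le v' x → le v v' ∨ le v' v)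
    {k : ℕ} {f g : Fin k → V}
    (P1 : ∀ v, v ≠ r → ∃ i, le v (f i))
    (P2 : ∀ v v', v ≠ r → le v v' → v ≠ v' →
      ∃ i, (le v (f i) ∧ ¬ le v' (f i)) ∨ (le v (g i) ∧ ¬ le v' (g i)))
    {π : Equiv.Perm (Fin k)} (good : ∀ i, ¬ SB le r (f i) (g (π i)))
    {a d : V} (h : Bad le r f g π a d) :
    ¬ SB le r a d ∧ (∀ x, le a x → ¬ le d x) ∧
      (∀ i, le a (f i) ↔ le d (g (π i))) ∧ (∀ i, le d (f i) ↔ le a (g (π i))) := by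
  have main : ∀ a d, Bad le r f g π a d → ¬ le a d := by
    rintro a d ⟨ha, hd, hne, hb⟩ hle
    obtain ⟨i, ⟨h1, h2⟩ | ⟨h1, h2⟩⟩ := P2 a d ha hle hne
    · have := (hb i).1 (Or.inl h1)
      have h3 := this.resolve_left h2
      exact good i ⟨a, ha, h1, htr _ _ _ hle h3⟩
    · have := (hb (π.symm i)).1 (Or.inr (by simpa using h1))
      have h3 := this.resolve_right (by simpa using h2)
      exact good (π.symm i) ⟨a, ha, htr _ _ _ hle h3, by simpa using h1⟩
  have n1 := main _ _ h
  have n2 := main _ _ h.symm'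
  obtain ⟨ha, hd, hne, hb⟩ := h
  have disj : ∀ x, le a x → ¬ le d x := by
    intro x h1 h2
    rcases hch _ _ _ h1 h2 with h | h
    · exact n1 h
    · exact n2 h
  have e1 : ∀ i, le a (f i) ↔ le d (g (π i)) := by
    intro i
    have := hb i
    have := disj (f i)
    have := disj (g (π i))
    tauto
  have e2 : ∀ i, le d (f i) ↔ le a (g (π i)) := by
    intro i
    have := hb i
    have := disj (f i)
    have := disj (g (π i))
    tauto
  refine ⟨?_, disj, e1, e2⟩
  rintro ⟨v, hv, h1, h2⟩
  obtain ⟨i, hi⟩ := P1 a ha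
  exact good i ⟨v, hv, htr _ _ _ h1 hi, htr _ _ _ h2 ((e1 i).1 hi)⟩

theorem improve {V : Type*} {le : V → V → Prop} {r : V}
    (htr : ∀ x y z, le x y → le y z → le x z)
    (hch : ∀ v v' x, le v x → le v' x → le v v' ∨ le v' v)
    {k : ℕ} {f g : Fin k → V}
    (P1 : ∀ v, v ≠ r → ∃ i, le v (f i))
    (P2 : ∀ v v', v ≠ r → le v v' → v ≠ v' →
      ∃ i, (le v (f i) ∧ ¬ le v' (f i)) ∨ (le v (g i) ∧ ¬ le v' (g i)))
    {π : Equiv.Perm (Fin k)} (good : ∀ i, ¬ SB le r (f i) (g (π i)))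
    {a d : V} (h : Bad le r f g π a d) (p q : Fin k)
    (hxa : ¬ le a (f p)) (hxd : ¬ le d (f p)) (hya : ¬ le a (g (π p))) (hyd : ¬ le d (g (π p)))
    (hq : le a (f q)) (hy : ¬ SB le r (g (π p)) a) (hx : ¬ SB le r (f p) d) :
    (∀ i, ¬ SB le r (f i) (g ((π * Equiv.swap p q) i))) ∧
    (∀ a' d', Bad le r f g (π * Equiv.swap p q) a' d' → Bad le r f g π a' d') ∧
    ¬ Bad le r f g (π * Equiv.swap p q) a d := by
  obtain ⟨nsb, disj, e1, e2⟩ := h.struct htr hch P1 P2 good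
  obtain ⟨ha, hd, hne, -⟩ := h
  have hpq : p ≠ q := by rintro rfl; exact hxa hq
  have hq' : le d (g (π q)) := (e1 q).1 hq
  have sp : (π * Equiv.swap p q) p = π q := by simp
  have sq : (π * Equiv.swap p q) q = π p := by simp
  have so : ∀ i, i ≠ p → i ≠ q → (π * Equiv.swap p q) i = π i := by
    intro i h1 h2
    simp [Equiv.swap_apply_of_ne_of_ne h1 h2]
  generalize π * Equiv.swap p q = π' at *
  have good' : ∀ i, ¬ SB le r (f i) (g (π' i)) := by
    intro i
    by_cases h1 : i = p
    · subst h1; rw [sp]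
      intro hs
      refine hx (hs.trans' htr hch ⟨d, hd, hq', ?_⟩)
      rcases hch _ _ _ hq' hq' with h | h <;> exact h
    by_cases h2 : i = q
    · subst h2; rw [sq]
      intro hs
      refine hy (hs.symm'.trans' htr hch ⟨a, ha, hq, ?_⟩)
      rcases hch _ _ _ hq hq with h | h <;> exact h
    rw [so i h1 h2]; exact good i
  refine ⟨good', ?_, ?_⟩
  swap
  · rintro ⟨-, -, -, hb⟩
    have := hb p
    rw [sp] at this
    have := disj (g (π q))
    tauto
  -- case (w, y) inside
  have caseA : ∀ a' d', Bad le r f g π' a' d' → le a' (f q) → le d' (g (π p)) →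
      le a' (f p) ∧ le d' (g (π q)) := by
    intro a' d' hb hw hyd'
    obtain ⟨nsb', disj', e1', e2'⟩ := hb.struct htr hch P1 P2 good'
    obtain ⟨ha', hd', hne', -⟩ := hb
    have fin : le d' d → le a' (f p) ∧ le d' (g (π q)) := by
      intro hdd
      have h3 : le d' (g (π q)) := htr _ _ _ hdd hq'
      refine ⟨(e1' p).2 (by rw [sp]; exact h3), h3⟩
    by_cases hle : le a' a
    · obtain ⟨s, hs⟩ := P1 d hd
      have s1 : s ≠ p := by rintro rfl; exact hxd hs
      have s2 : s ≠ q := by rintro rfl; exact disj _ hq hs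
      have hz := htr _ _ _ hle ((e2 s).1 hs)
      rw [← so s s1 s2] at hz
      have hz' := (e2' s).2 hz
      rcases hch _ _ _ hs hz' with hh | hh
      · exact absurd (htr _ _ _ hh hyd') hyd
      · exact fin hh
    · have hle' : le a a' := (hch _ _ _ hw hq).resolve_left hle
      have hnaa : a ≠ a' := by rintro rfl; exact hle hle'
      obtain ⟨u, hu⟩ := P1 d' hd'
      have hpu := (e2' u).1 hu
      have u2 : u ≠ q := by rintro rfl; exact disj' _ hw hu
      have u1 : u ≠ p := by
        rintro rfl
        rw [sp] at hpu
        exact disj _ (htr _ _ _ hle' hpu) hq'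
      rw [so u u1 u2] at hpu
      have hud := (e2 u).2 (htr _ _ _ hle' hpu)
      rcases hch _ _ _ hud hu with hh | hh
      · exact absurd (htr _ _ _ hh hyd') hyd
      exfalso
      obtain ⟨i, ⟨h1, h2⟩ | ⟨h1, h2⟩⟩ := P2 a a' ha hle' hnaa
      · have i1 : i ≠ p := by rintro rfl; exact hxa h1
        have i2 : i ≠ q := by rintro rfl; exact h2 hw
        have := htr _ _ _ hh ((e1 i).1 h1)
        rw [← so i i1 i2] at this
        exact h2 ((e1' i).2 this)
      · obtain ⟨j, rfl⟩ := π.surjective i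
        have hj := (e2 j).2 h1
        have i1 : j ≠ p := by rintro rfl; exact hxd hj
        have i2 : j ≠ q := by rintro rfl; exact disj _ hq hj
        have := (e2' j).1 (htr _ _ _ hh hj)
        rw [so j i1 i2] at this
        exact h2 this
  have caseB : ∀ a' d', Bad le r f g π' a' d' → le a' (f p) → le d' (g (π q)) →
      le a' (f q) ∧ le d' (g (π p)) := by
    intro a' d' hb hxa' hwd'
    obtain ⟨nsb', disj', e1', e2'⟩ := hb.struct htr hch P1 P2 good'
    obtain ⟨ha', hd', hne', -⟩ := hb
    have fin : le a' a → le a' (f q) ∧ le d' (g (π p)) := by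
      intro haa
      have h3 : le a' (f q) := htr _ _ _ haa hq
      refine ⟨h3, ?_⟩
      rw [← sq]; exact (e1' q).1 h3
    by_cases hle : le d' d
    · obtain ⟨s, hs⟩ := P1 d hd
      have s1 : s ≠ p := by rintro rfl; exact hxd hs
      have s2 : s ≠ q := by rintro rfl; exact disj _ hq hs
      have hz := (e2' s).1 (htr _ _ _ hle hs)
      rw [so s s1 s2] at hz
      have hz' := (e2 s).1 hs
      rcases hch _ _ _ hz' hz with hh | hh
      · exact absurd (htr _ _ _ hh hxa') hxa
      · exact fin hh
    · have hle' : le d d' := (hch _ _ _ hwd' hq').resolve_left hle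
      have hnaa : d ≠ d' := by rintro rfl; exact hle hle'
      obtain ⟨u, hu⟩ := P1 d' hd'
      have hpu := (e2' u).1 hu
      have u1 : u ≠ p := by rintro rfl; exact disj' _ hxa' hu
      have u2 : u ≠ q := by
        rintro rfl
        exact disj _ hq (htr _ _ _ hle' hu)
      rw [so u u1 u2] at hpu
      have hud := (e2 u).1 (htr _ _ _ hle' hu)
      rcases hch _ _ _ hud hpu with hh | hh
      · exact absurd (htr _ _ _ hh hxa') hxa
      exfalso
      obtain ⟨i, ⟨h1, h2⟩ | ⟨h1, h2⟩⟩ := P2 d d' hd hle' hnaa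
      · have i1 : i ≠ p := by rintro rfl; exact hxd h1
        have i2 : i ≠ q := by rintro rfl; exact disj _ hq h1
        have := htr _ _ _ hh ((e2 i).1 h1)
        rw [← so i i1 i2] at this
        exact h2 ((e2' i).2 this)
      · obtain ⟨j, rfl⟩ := π.surjective i
        have hj := (e1 j).2 h1
        have i1 : j ≠ p := by rintro rfl; exact hxa hj
        have i2 : j ≠ q := by rintro rfl; exact h2 hwd'
        have := (e1' j).1 (htr _ _ _ hh hj)
        rw [so j i1 i2] at this
        exact h2 this
  intro a' d' hb
  have A1 := caseA a' d' hb
  have A2 := caseA d' a' hb.symm'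
  have B1 := caseB a' d' hb
  have B2 := caseB d' a' hb.symm'
  obtain ⟨nsb', disj', e1', e2'⟩ := hb.struct htr hch P1 P2 good'
  refine ⟨hb.1, hb.2.1, hb.2.2.1, ?_⟩
  have p1 := e1' p
  have p2 := e2' p
  have q1 := e1' q
  have q2 := e2' q
  rw [sp] at p1 p2
  rw [sq] at q1 q2
  intro i
  clear hb e1 e2 caseA caseB hxa hxd hya hyd hq hq' hy hx nsb nsb' disj disj'
  by_cases h1 : i = p
  · subst h1; clear e1' e2' so; grind
  by_cases h2 : i = q
  · subst h2; clear e1' e2' so; grind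
  have i1 := e1' i
  have i2 := e2' i
  rw [so i h1 h2] at i1 i2
  clear A1 A2 B1 B2 p1 p2 q1 q2
  tauto

theorem core {V : Type*} [Fintype V] (le : V → V → Prop) (r : V)
    (htr : ∀ x y z, le x y → le y z → le x z)
    (hch : ∀ v v' x, le v x → le v' x → le v v' ∨ le v' v)
    (k : ℕ) (f g : Fin k → V)
    (P1 : ∀ v, v ≠ r → ∃ i, le v (f i))
    (P2 : ∀ v v', v ≠ r → le v v' → v ≠ v' →
      ∃ i, (le v (f i) ∧ ¬ le v' (f i)) ∨ (le v (g i) ∧ ¬ le v' (g i)))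
    (P3 : ∀ a d, a ≠ r → d ≠ r → ¬ SB le r a d →
      ∃ i, (¬ le a (f i) ∧ ¬ le d (f i)) ∨ (¬ le a (g i) ∧ ¬ le d (g i)))
    (P4 : ∀ v, v ≠ r → ∃ c, c ≠ r ∧ le c v ∧ (∀ w, w ≠ r → le w c → w = c) ∧
      (∑ i, if le c (f i) then 1 else 0) + (∑ i, if le c (g i) then 1 else 0) ≤ k) :
    ∃ π : Equiv.Perm (Fin k), (∀ i, ¬ SB le r (f i) (g (π i))) ∧
      ∀ a d, ¬ Bad le r f g π a d := by
  obtain ⟨π₀, h₀⟩ := step1 le r htr hch k f g P4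
  obtain ⟨π, hπ, hmin⟩ := Finset.exists_min_image
    (Finset.univ.filter (fun π : Equiv.Perm (Fin k) => ∀ i, ¬ SB le r (f i) (g (π i))))
    (fun π => (Finset.univ.filter (fun x : V × V => Bad le r f g π x.1 x.2)).card)
    ⟨π₀, by simpa using h₀⟩
  have good : ∀ i, ¬ SB le r (f i) (g (π i)) := by simpa using hπ
  refine ⟨π, good, ?_⟩
  have fin : ∀ a d, Bad le r f g π a d → ∀ p, ¬ le a (f p) → ¬ le d (f p) → ¬ le a (g (π p)) →
      ¬ le d (g (π p)) → ¬ SB le r (g (π p)) a → ¬ SB le r (f p) d → False := by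
    intro a d h p h1 h2 h3 h4 h5 h6
    obtain ⟨q, hq⟩ := P1 a h.1
    obtain ⟨c1, c2, c3⟩ := improve htr hch P1 P2 good h p q h1 h2 h3 h4 hq h5 h6
    refine absurd (hmin (π * Equiv.swap p q) (by simpa using c1))
      (not_le.mpr (Finset.card_lt_card ?_))
    rw [Finset.ssubset_iff_of_subset]
    · exact ⟨(a, d), by simpa using h, by simpa using c3⟩
    · intro x
      simp only [Finset.mem_filter_univ]
      exact c2 _ _
  intro a d h
  obtain ⟨nsb, disj, e1, e2⟩ := h.struct htr hch P1 P2 good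
  obtain ⟨p, m1, m2, m3, m4⟩ : ∃ p, ¬ le a (f p) ∧ ¬ le d (f p) ∧ ¬ le a (g (π p)) ∧
      ¬ le d (g (π p)) := by
    obtain ⟨i, hi | hi⟩ := P3 a d h.1 h.2.1 nsb
    · exact ⟨i, by have := e1 i; have := e2 i; tauto⟩
    · obtain ⟨j, rfl⟩ := π.surjective i
      exact ⟨j, by have := e1 j; have := e2 j; tauto⟩
  by_cases s1 : SB le r (f p) a
  · exact fin a d h p m1 m2 m3 m4 (fun hh => good p (s1.trans' htr hch hh.symm'))
      (fun hh => nsb (s1.symm'.trans' htr hch hh))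
  by_cases s2 : SB le r (g (π p)) d
  · exact fin a d h p m1 m2 m3 m4 (fun hh => nsb (hh.symm'.trans' htr hch s2))
      (fun hh => good p (hh.trans' htr hch s2.symm'))
  exact fin d a h.symm' p m2 m1 m4 m3 s2 s1

section treepart

variable {G : SimpleGraph V} {r : V} {P : ∀ x, G.Walk r x}

theorem tp_pref (hA : G.IsAcyclic) (hP : ∀ x, (P x).IsPath) {v x : V} (h : v ∈ (P x).support) :
    ∃ q : G.Walk v x, P x = (P v).append q ∧ q.IsPath := by
  obtain ⟨p₀, p₁, h0, h1, h2⟩ := (hP x).mem_support_iff_exists_append.mp h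
  have : p₀ = P v := Subtype.mk.inj <| hA.subsingleton_path r v |>.elim ⟨p₀, h0⟩ ⟨P v, hP v⟩
  subst this
  exact ⟨p₁, h2, h1⟩

theorem tp_trans (hA : G.IsAcyclic) (hP : ∀ x, (P x).IsPath) (x y z : V)
    (h : x ∈ (P y).support) (h' : y ∈ (P z).support) : x ∈ (P z).support := by
  obtain ⟨q, hq, -⟩ := tp_pref hA hP h'
  rw [hq, Walk.mem_support_append_iff]
  exact Or.inl h

theorem tp_chain (hA : G.IsAcyclic) (hP : ∀ x, (P x).IsPath) (v v' x : V)
    (h : v ∈ (P x).support) (h' : v' ∈ (P x).support) :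
    v ∈ (P v').support ∨ v' ∈ (P v).support := by
  obtain ⟨q, hq, hq'⟩ := tp_pref hA hP h
  rw [hq, Walk.mem_support_append_iff] at h'
  rcases h' with h' | h'
  · exact Or.inr h'
  · left
    obtain ⟨q1, q2, -, -, e⟩ := hq'.mem_support_iff_exists_append.mp h'
    have hp := hP x
    rw [hq, e, Walk.append_assoc] at hp
    have : (P v).append q1 = P v' :=
      Subtype.mk.inj <| hA.subsingleton_path r v' |>.elim ⟨_, hp.of_append_left⟩ ⟨P v', hP v'⟩
    rw [← this, Walk.mem_support_append_iff]
    exact Or.inl (Walk.end_mem_support _)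

theorem tp_child (hA : G.IsAcyclic) (hP : ∀ x, (P x).IsPath) {v c : V} (h : G.Adj v c)
    (hc : c ∉ (P v).support) : P c = (P v).concat h :=
  Subtype.mk.inj <| hA.subsingleton_path r c |>.elim ⟨P c, hP c⟩ ⟨_, (hP v).concat hc h⟩

theorem tp_child_mem (hA : G.IsAcyclic) (hP : ∀ x, (P x).IsPath) {v c w : V} (h : G.Adj v c)
    (hc : c ∉ (P v).support) : w ∈ (P c).support ↔ w ∈ (P v).support ∨ w = c := by
  rw [tp_child hA hP h hc, Walk.support_concat]
  simp

theorem tp_next (hA : G.IsAcyclic) (hP : ∀ x, (P x).IsPath) {v x : V} (h : v ∈ (P x).support)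
    (hne : v ≠ x) : ∃ c, G.Adj v c ∧ c ∉ (P v).support ∧ c ∈ (P x).support := by
  obtain ⟨q, hq, hq'⟩ := tp_pref hA hP h
  cases q with
  | nil => exact absurd rfl hne
  | @cons _ c _ hadj q' =>
    refine ⟨c, hadj, ?_, ?_⟩
    · have hp := hP x
      rw [hq, ← Walk.concat_append] at hp
      exact ((Walk.concat_isPath_iff hadj).1 hp.of_append_left).2
    · rw [hq, Walk.mem_support_append_iff]
      right
      simp

theorem tp_child_unique (hA : G.IsAcyclic) (hP : ∀ x, (P x).IsPath) {v c c' x : V}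
    (h : G.Adj v c) (hc : c ∉ (P v).support) (h' : G.Adj v c') (hc' : c' ∉ (P v).support)
    (hx : c ∈ (P x).support) (hx' : c' ∈ (P x).support) : c = c' := by
  rcases tp_chain hA hP _ _ _ hx hx' with e | e
  · exact ((tp_child_mem hA hP h' hc').1 e).resolve_left hc
  · exact (((tp_child_mem hA hP h hc).1 e).resolve_left hc').symm

theorem tp_refl (x : V) : x ∈ (P x).support := Walk.end_mem_support _

theorem tp_root (hP : ∀ x, (P x).IsPath) {x : V} (h : x ∈ (P r).support) : x = r := by
  have : P r = Walk.nil := Walk.isPath_iff_nil.mp (hP r) |>.eq_nil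
  rw [this] at h
  simpa using h

/-- two neighbours in the ancestor path coincide -/
theorem tp_parent_unique (hA : G.IsAcyclic) (hP : ∀ x, (P x).IsPath) {x y z : V}
    (hy : G.Adj x y) (hz : G.Adj x z) (h1 : y ∈ (P x).support) (h2 : z ∈ (P x).support) :
    y = z := by
  rw [hA.eq_penultimate_of_adj_end (hP x) hy h1, hA.eq_penultimate_of_adj_end (hP x) hz h2]

theorem tp_parent (hA : G.IsAcyclic) (hP : ∀ x, (P x).IsPath) {x : V} (hx : x ≠ r) :
    ∃ p, ∃ h : G.Adj p x, p ∈ (P x).support ∧ P x = (P p).concat h := by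
  have hn : ¬ (P x).Nil := fun h => hx h.eq.symm
  have hadj := (P x).adj_penultimate hn
  have hm : (P x).penultimate ∈ (P x).support := Walk.getVert_mem_support _ _
  exact ⟨_, hadj, hm, hA.path_concat (hP _) (hP x) hadj hm⟩

theorem tp_leaf [Fintype V] (hA : G.IsAcyclic) (hP : ∀ x, (P x).IsPath) {v : V} (hv : v ≠ r) :
    ∃ x, G.degree x = 1 ∧ v ∈ (P x).support := by
  obtain ⟨x, hx, hmax⟩ := Finset.exists_max_image
    (Finset.univ.filter (fun x => v ∈ (P x).support)) (fun x => (P x).length)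
    ⟨v, by simp⟩
  simp only [Finset.mem_filter_univ] at hx hmax
  refine ⟨x, ?_, hx⟩
  have hxr : x ≠ r := by
    rintro rfl
    exact hv (tp_root hP hx)
  obtain ⟨p, hadj, hp, -⟩ := tp_parent hA hP hxr
  rw [degree_eq_one_iff_existsUnique_adj]
  refine ⟨p, hadj.symm, fun y hy => ?_⟩
  by_cases hm : y ∈ (P x).support
  · exact tp_parent_unique hA hP hy hadj.symm hm hp
  · have h1 := hmax y ((tp_child_mem hA hP hy hm).2 (Or.inl hx))
    rw [tp_child hA hP hy hm] at h1
    simp at h1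

theorem tp_third [Fintype V] {v p c : V} (h0 : G.Adj v p) (h0' : G.Adj v c) (hpc : p ≠ c)
    (h2 : G.degree v ≠ 2) : ∃ n, G.Adj v n ∧ n ≠ p ∧ n ≠ c := by
  by_contra hcon
  push Not at hcon
  apply h2
  rw [← card_neighborFinset_eq_degree]
  have : G.neighborFinset v = {p, c} := by
    ext n
    simp only [mem_neighborFinset, Finset.mem_insert, Finset.mem_singleton]
    constructor
    · intro h
      by_contra hh
      push Not at hh
      exact hh.2 (hcon n h hh.1)
    · rintro (rfl | rfl) <;> assumption
  rw [this, Finset.card_pair hpc]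

theorem tp_dist (hA : G.IsTree) (hP : ∀ x, (P x).IsPath) (x : V) :
    (P x).length = G.dist r x := by
  obtain ⟨p, hp, hl⟩ := hA.connected.exists_path_of_dist r x
  rw [← hl]
  exact congrArg Walk.length
    (Subtype.mk.inj <| hA.isAcyclic.subsingleton_path r x |>.elim ⟨P x, hP x⟩ ⟨p, hp⟩)

theorem tp_edge (hA : G.IsAcyclic) (hP : ∀ x, (P x).IsPath) {e : Sym2 V} (he : e ∈ G.edgeSet) :
    ∃ v, v ≠ r ∧ (∃ p, e = s(p, v) ∧ G.Adj p v ∧ p ∈ (P v).support) ∧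
      ∀ x, e ∈ (P x).edges ↔ v ∈ (P x).support := by
  have key : ∀ a b, G.Adj a b → b ∉ (P a).support →
      ∃ v, v ≠ r ∧ (∃ p, s(a, b) = s(p, v) ∧ G.Adj p v ∧ p ∈ (P v).support) ∧
      ∀ x, s(a, b) ∈ (P x).edges ↔ v ∈ (P x).support := by
    intro a b hadj hb
    refine ⟨b, ?_, ⟨a, rfl, hadj, (tp_child_mem hA hP hadj hb).2 (Or.inl (tp_refl a))⟩, ?_⟩
    · rintro rfl
      exact hb (Walk.start_mem_support _)
    intro x
    constructor
    · intro h
      exact Walk.snd_mem_support_of_mem_edges _ h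
    · intro h
      obtain ⟨q, hq, -⟩ := tp_pref hA hP h
      rw [hq, tp_child hA hP hadj hb]
      simp [Walk.edges_append, Walk.edges_concat]
  induction e with
  | _ a b =>
    rw [mem_edgeSet] at he
    by_cases hb : b ∈ (P a).support
    · have := hA.ne_mem_support_of_support_of_adj_of_isPath (hP a) (hP b) he hb
      obtain h := key b a he.symm this
      rwa [Sym2.eq_swap] at h
    · exact key a b he hb

theorem tp_path (hP : ∀ x, (P x).IsPath) {x y : V}
    (h : ¬ SB (fun v x => v ∈ (P x).support) r x y) :
    ((P x).reverse.append (P y)).IsPath := by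
  rw [Walk.isPath_def, Walk.support_append, List.nodup_append']
  have hn := (hP y).support_nodup
  rw [← Walk.cons_tail_support] at hn
  refine ⟨by simpa using (hP x).support_nodup, (List.nodup_cons.1 hn).2, ?_⟩
  intro v h1 h2
  refine h ⟨v, ?_, by simpa using h1, List.mem_of_mem_tail h2⟩
  rintro rfl
  exact (List.nodup_cons.1 hn).1 h2

end treepart

theorem surj_fin [Nonempty V] (S : Finset V) (k : ℕ) (h : S.card ≤ k) :
    ∃ f : Fin k → V, ∀ x ∈ S, ∃ i, f i = x := by
  obtain ⟨d⟩ := ‹Nonempty V›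
  refine ⟨fun i => S.toList.getD i d, fun x hx => ?_⟩
  obtain ⟨n, hn, e⟩ := List.mem_iff_getElem.1 (Finset.mem_toList.2 hx)
  have : n < S.card := by simpa using hn
  refine ⟨⟨n, by omega⟩, ?_⟩
  exact (List.getD_eq_getElem _ _ hn).trans e

theorem tokens [Nonempty V] (L D : Finset V) (h : L.card ≤ D.card) :
    ∃ f g : Fin ((L.card + D.card + 1) / 2) → V, (∀ x ∈ L, ∃ i, f i = x) ∧
      ∀ x ∈ D, (∃ i, f i = x) ∨ ∃ i, g i = x := by
  obtain ⟨D1, hD1, hc⟩ := Finset.exists_subset_card_eq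
    (show (L.card + D.card + 1) / 2 - L.card ≤ D.card by omega)
  obtain ⟨f, hf⟩ := surj_fin (L ∪ D1) ((L.card + D.card + 1) / 2)
    ((Finset.card_union_le _ _).trans (by omega))
  obtain ⟨g, hg⟩ := surj_fin (D \ D1) ((L.card + D.card + 1) / 2)
    (by rw [Finset.card_sdiff_of_subset hD1]; omega)
  refine ⟨f, g, fun x hx => hf x (Finset.mem_union_left _ hx), fun x hx => ?_⟩
  by_cases h : x ∈ D1
  · exact Or.inl (hf x (Finset.mem_union_right _ h))
  · exact Or.inr (hg x (Finset.mem_sdiff.2 ⟨hx, h⟩))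

theorem main_tokens [Fintype V] (G : SimpleGraph V) (hT : G.IsTree) (k : ℕ) (f g : Fin k → V)
    (hf : ∀ x, G.degree x = 1 → ∃ i, f i = x)
    (hg : ∀ x, G.degree x = 2 → (∃ i, f i = x) ∨ ∃ i, g i = x) :
    ∃ F : Fin k → PathIn G, EdgeSep G (Set.range F) ∧ EdgeCover G (Set.range F) := by
  have hA := hT.isAcyclic
  have := hT.connected.nonempty
  obtain ⟨r, -, hr⟩ := Finset.exists_min_image (Finset.univ : Finset V)
    (fun r => ∑ i, (G.dist r (f i) + G.dist r (g i))) Finset.univ_nonempty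
  choose P hP _ using fun x => hT.existsUnique_path r x
  have P1 : ∀ v, v ≠ r → ∃ i, v ∈ (P (f i)).support := by
    intro v hv
    obtain ⟨x, hx, hm⟩ := tp_leaf hA hP hv
    obtain ⟨i, rfl⟩ := hf x hx
    exact ⟨i, hm⟩
  suffices hC : ∃ π : Equiv.Perm (Fin k),
      (∀ i, ¬ SB (fun v x => v ∈ (P x).support) r (f i) (g (π i))) ∧
      ∀ a d, ¬ Bad (fun v x => v ∈ (P x).support) r f g π a d by
    obtain ⟨π, good, nobad⟩ := hC
    refine ⟨fun i => ⟨f i, g (π i), (P (f i)).reverse.append (P (g (π i))), tp_path hP (good i)⟩,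
      ?_, ?_⟩
    · intro e he e' he' hne
      obtain ⟨v, hv, ⟨p, hp, hpa, hps⟩, hve⟩ := tp_edge hA hP he
      obtain ⟨v', hv', ⟨p', hp', hpa', hps'⟩, hve'⟩ := tp_edge hA hP he'
      have hvv : v ≠ v' := by
        rintro rfl
        rw [tp_parent_unique hA hP hpa.symm hpa'.symm hps hps'] at hp
        exact hne (hp.trans hp'.symm)
      have := nobad v v'
      by_contra hcon
      refine this ⟨hv, hv', hvv, fun i => ?_⟩
      by_contra hi
      refine hcon ⟨_, ⟨i, rfl⟩, ?_⟩
      simp only [PathIn.emem, Walk.edges_append, Walk.edges_reverse, List.mem_append,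
        List.mem_reverse, hve, hve']
      tauto
    · intro e he
      obtain ⟨v, hv, -, hve⟩ := tp_edge hA hP he
      obtain ⟨i, hi⟩ := P1 v hv
      refine ⟨_, ⟨i, rfl⟩, ?_⟩
      simp only [PathIn.emem, Walk.edges_append, Walk.edges_reverse, List.mem_append,
        List.mem_reverse, hve]
      exact Or.inl hi
  refine core (fun v x => v ∈ (P x).support) r (tp_trans hA hP)
    (tp_chain hA hP) k f g P1 ?_ ?_ ?_
  · intro v v' hv hle hne
    obtain ⟨p, hadj, hp, -⟩ := tp_parent hA hP hv
    obtain ⟨c, hc, hcv, hcv'⟩ := tp_next hA hP hle hne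
    have hnv : v' ∉ (P v).support := by
      intro h
      exact hcv (tp_trans hA hP _ _ _ hcv' h)
    by_cases h2 : G.degree v = 2
    · rcases hg v h2 with ⟨i, rfl⟩ | ⟨i, rfl⟩
      · exact ⟨i, Or.inl ⟨tp_refl _, hnv⟩⟩
      · exact ⟨i, Or.inr ⟨tp_refl _, hnv⟩⟩
    · obtain ⟨n, hn, hnp, hnc⟩ := tp_third hadj.symm hc (by rintro rfl; exact hcv hp) h2
      have hns : n ∉ (P v).support := fun h =>
        hnp (tp_parent_unique hA hP hn hadj.symm h hp)
      obtain ⟨i, hi⟩ := P1 n (by rintro rfl; exact hns (Walk.start_mem_support _))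
      refine ⟨i, Or.inl ⟨tp_trans hA hP _ _ _ ((tp_child_mem hA hP hn hns).2
        (Or.inl (tp_refl v))) hi, fun h => ?_⟩⟩
      exact hnc (tp_child_unique hA hP hn hns hc hcv hi (tp_trans hA hP _ _ _ hcv' h))
  · intro a d ha hd hsb
    obtain ⟨c, hc, hcv, hca⟩ := tp_next hA hP (Walk.start_mem_support (P a)) ha.symm
    obtain ⟨c', hc', hcv', hcd⟩ := tp_next hA hP (Walk.start_mem_support (P d)) hd.symm
    have hcr : ∀ c, G.Adj r c → c ∉ (P r).support := fun c h hm => h.ne (tp_root hP hm).symm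
    have hcc : c ≠ c' := by
      rintro rfl
      exact hsb ⟨c, hc.ne', hca, hcd⟩
    by_cases h2 : G.degree r = 2
    · have na : a ∉ (P r).support := fun h => ha (tp_root hP h)
      have nd : d ∉ (P r).support := fun h => hd (tp_root hP h)
      rcases hg r h2 with ⟨i, hi⟩ | ⟨i, hi⟩
      · exact ⟨i, Or.inl (by rw [hi]; exact ⟨na, nd⟩)⟩
      · exact ⟨i, Or.inr (by rw [hi]; exact ⟨na, nd⟩)⟩
    · obtain ⟨n, hn, hnp, hnc⟩ := tp_third hc hc' hcc h2
      obtain ⟨i, hi⟩ := P1 n hn.ne'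
      refine ⟨i, Or.inl ⟨fun h => ?_, fun h => ?_⟩⟩
      · exact hnp (tp_child_unique hA hP hn (hcr n hn) hc hcv hi (tp_trans hA hP _ _ _ hca h))
      · exact hnc (tp_child_unique hA hP hn (hcr n hn) hc' hcv' hi (tp_trans hA hP _ _ _ hcd h))
  · intro v hv
    obtain ⟨c, hc, hcv, hca⟩ := tp_next hA hP (Walk.start_mem_support (P v)) hv.symm
    refine ⟨c, hc.ne', hca, ?_, ?_⟩
    · intro w hw hwc
      exact ((tp_child_mem hA hP hc hcv).1 hwc).resolve_left (fun h => hw (tp_root hP h))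
    · have hd : ∀ t, G.dist c t + 2 * (if c ∈ (P t).support then 1 else 0) ≤ G.dist r t + 1 := by
        intro t
        split_ifs with h
        · obtain ⟨q, hq, -⟩ := tp_pref hA hP h
          have h1 := tp_dist hT hP t
          rw [hq, tp_child hA hP hc hcv] at h1
          simp only [Walk.length_append, Walk.length_concat] at h1
          have := G.dist_le q
          omega
        · have h1 := hT.connected.dist_triangle (u := c) (v := r) (w := t)
          have h2 : G.dist c r = 1 := dist_eq_one_iff_adj.2 hc.symm
          omega
      have h1 := hr c (Finset.mem_univ _)
      have h2 : ∑ i, ((G.dist c (f i) + 2 * (if c ∈ (P (f i)).support then 1 else 0)) +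
          (G.dist c (g i) + 2 * (if c ∈ (P (g i)).support then 1 else 0))) ≤
          ∑ i, ((G.dist r (f i) + 1) + (G.dist r (g i) + 1)) :=
        Finset.sum_le_sum fun i _ => add_le_add (hd _) (hd _)
      simp only [Finset.sum_add_distrib, ← Finset.mul_sum, Finset.sum_const, Finset.card_univ,
        Fintype.card_fin, smul_eq_mul, mul_one] at h1 h2
      have h3 : (∑ i, if c ∈ (P (f i)).support then 1 else 0) +
          (∑ i, if c ∈ (P (g i)).support then 1 else 0) ≤ k := by omega
      convert h3

theorem stmt7 [Fintype V] (G : SimpleGraph V) (hT : G.IsTree)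
    (h12 : leafCount G ≤ deg2Count G) :
    ∃ F : Set (PathIn G), F.Finite ∧ EdgeSep G F ∧ EdgeCover G F ∧
      F.ncard ≤ (leafCount G + deg2Count G + 1) / 2 := by
  have := hT.connected.nonempty
  have e1 : leafCount G = (Finset.univ.filter (fun x => G.degree x = 1)).card := by
    unfold leafCount
    rw [Nat.card_coe_set_eq, ← Set.ncard_coe_finset]
    congr 1
    ext x
    simp
  have e2 : deg2Count G = (Finset.univ.filter (fun x => G.degree x = 2)).card := by
    unfold deg2Count
    rw [Nat.card_coe_set_eq, ← Set.ncard_coe_finset]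
    congr 1
    ext x
    simp
  rw [e1, e2] at h12 ⊢
  obtain ⟨f, g, hf, hg⟩ := tokens _ _ h12
  obtain ⟨F, h1, h2⟩ := main_tokens G hT _ f g
    (fun x hx => hf x (by simpa using hx)) (fun x hx => hg x (by simpa using hx))
  refine ⟨Set.range F, Set.finite_range F, h1, h2, ?_⟩
  rw [← Nat.card_coe_set_eq]
  refine (Finite.card_range_le F).trans ?_
  simp
end

section
/- Let T be a tree with no degree-2 vertices, h₁(T) = 3k leaves for some k ≥ 1, and |V(T)| ≥ 3. Then there exists a family of 2k paths in T that separates and covers E(T). -/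
open SimpleGraph
open scoped Classical

universe u

variable {V : Type u}

theorem comb_aux (k : ℕ) (A B : ℕ → Prop)
    (hA : ∀ i j m, i < j → j < m → m < 3 * k → A i → A m → A j)
    (hB : ∀ i j m, i < j → j < m → m < 3 * k → B i → B m → B j)
    (h1 : ∀ i < k, ((A i ↔ B i) ↔ (A (i + k) ↔ B (i + k))))
    (h2 : ∀ i < k, ((A i ↔ B i) ↔ (A (i + 2 * k) ↔ B (i + 2 * k))))
    (i j : ℕ) (hij : i < j) (hj : j < k) : (A i ↔ B i) ↔ (A j ↔ B j) := by
  have a1 := h1 i (by omega)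
  have a2 := h2 i (by omega)
  have b1 := h1 j hj
  have b2 := h2 j hj
  have key : ∀ C : ℕ → Prop, (∀ i j m, i < j → j < m → m < 3 * k → C i → C m → C j) →
      (C i → C (i+k) → C j) ∧ (C i → C (j+k) → C j ∧ C (i + k)) ∧
      (C i → C (i+2*k) → C j ∧ C (i + k) ∧ C (j + k)) ∧
      (C i → C (j+2*k) → C j ∧ C (i + k) ∧ C (j + k) ∧ C (i + 2 * k)) ∧
      (C j → C (j+k) → C (i + k)) ∧ (C j → C (i+2*k) → C (i + k) ∧ C (j+k)) ∧
      (C j → C (j+2*k) → C (i + k) ∧ C (j+k) ∧ C (i + 2 *k)) ∧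
      (C (i+k) → C (i+2*k) → C (j+k)) ∧ (C (i+k) → C (j+2*k) → C (j+k) ∧ C (i+2*k)) ∧
      (C (j+k) → C (j+2*k) → C (i+2*k)) := by
    intro C hC
    have := fun a b c (h : a < b ∧ b < c ∧ c < 3 * k) => hC a b c h.1 h.2.1 h.2.2
    refine ⟨?_, ?_, ?_, ?_, ?_, ?_, ?_, ?_, ?_, ?_⟩ <;> intro x y <;> (try refine ⟨?_, ?_⟩) <;>
      (try refine ⟨?_, ?_⟩) <;> (try refine ⟨?_, ?_⟩) <;>
      exact this _ _ _ (by omega) x y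
  have kA := key A hA
  have kB := key B hB
  clear key h1 h2 hA hB
  generalize A i = p1 at *
  generalize A j = p2 at *
  generalize A (i+k) = p3 at *
  generalize A (j+k) = p4 at *
  generalize A (i+2*k) = p5 at *
  generalize A (j+2*k) = p6 at *
  generalize B i = q1 at *
  generalize B j = q2 at *
  generalize B (i+k) = q3 at *
  generalize B (j+k) = q4 at *
  generalize B (i+2*k) = q5 at *
  generalize B (j+2*k) = q6 at *
  by_cases p1 <;> by_cases p2 <;> by_cases p3 <;> by_cases p4 <;> by_cases p5 <;> by_cases p6 <;>
    grind

theorem comb (k : ℕ) (A B : ℕ → Prop)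
    (hA : ∀ i j m, i < j → j < m → m < 3 * k → A i → A m → A j)
    (hB : ∀ i j m, i < j → j < m → m < 3 * k → B i → B m → B j)
    (h1 : ∀ i < k, ((A i ↔ B i) ↔ (A (i + k) ↔ B (i + k))))
    (h2 : ∀ i < k, ((A i ↔ B i) ↔ (A (i + 2 * k) ↔ B (i + 2 * k))))
    (i j : ℕ) (hi : i < 3 * k) (hj : j < 3 * k) : (A i ↔ B i) ↔ (A j ↔ B j) := by
  have base : ∀ i j, i < k → j < k → ((A i ↔ B i) ↔ (A j ↔ B j)) := by
    intro i j hi hj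
    rcases lt_trichotomy i j with h | h | h
    · exact comb_aux k A B hA hB h1 h2 i j h hj
    · rw [h]
    · exact (comb_aux k A B hA hB h1 h2 j i h hi).symm
  have red : ∀ i < 3 * k, ∃ i' < k, ((A i ↔ B i) ↔ (A i' ↔ B i')) := by
    intro i hi
    by_cases c1 : i < k
    · exact ⟨i, c1, Iff.rfl⟩
    by_cases c2 : i < 2 * k
    · refine ⟨i - k, by omega, ?_⟩
      have := h1 (i - k) (by omega)
      rw [Nat.sub_add_cancel (by omega)] at this
      exact this.symm
    · refine ⟨i - 2 * k, by omega, ?_⟩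
      have := h2 (i - 2 * k) (by omega)
      rw [Nat.sub_add_cancel (by omega)] at this
      exact this.symm
  obtain ⟨i', hi', e1⟩ := red i hi
  obtain ⟨j', hj', e2⟩ := red j hj
  rw [e1, e2]
  exact base i' j' hi' hj'

theorem prefix_convex (p : List ℕ) : ∀ (a b c : List ℕ), a < b → b < c →
    p <+: a → p <+: c → p <+: b := by
  induction p with
  | nil => intros; exact List.nil_prefix
  | cons x p ih =>
    rintro a b c hab hbc ⟨a', rfl⟩ ⟨c', rfl⟩
    cases b with
    | nil => exact absurd hab (by simp)
    | cons y b =>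
      simp only [List.cons_append, List.cons_lt_cons_iff] at hab hbc
      have hxy : x = y := by omega
      subst hxy
      simp only [lt_irrefl, false_or, true_and] at hab hbc
      have := ih _ _ _ hab hbc (List.prefix_append _ _) (List.prefix_append _ _)
      exact List.cons_prefix_cons.2 ⟨rfl, this⟩

theorem enum (L : Finset V) (n : ℕ) (hn : L.card = n) (key : V → List ℕ)
    (hk : Function.Injective key) (r : V) :
    ∃ l : ℕ → V, (∀ i < n, l i ∈ L) ∧ (∀ x ∈ L, ∃ i < n, l i = x) ∧
      ∀ i j, i < j → j < n → key (l i) < key (l j) := by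
  have hc : (L.image key).card = n := by rw [Finset.card_image_of_injective _ hk, hn]
  let f := (L.image key).orderEmbOfFin hc
  have hf : ∀ i, ∃ x ∈ L, key x = f i := fun i => by
    exact Finset.mem_image.1 (Finset.orderEmbOfFin_mem (L.image key) hc i)
  choose g hg1 hg2 using hf
  refine ⟨fun i => if h : i < n then g ⟨i, h⟩ else r, ?_, ?_, ?_⟩
  · intro i hi; simp [hi, hg1]
  · intro x hx
    have : key x ∈ Set.range f := by
      rw [Finset.range_orderEmbOfFin]; simpa using ⟨x, hx, rfl⟩
    obtain ⟨i, hi⟩ := this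
    refine ⟨i, i.2, ?_⟩
    simp only [i.2, dite_true]
    exact hk ((hg2 i).trans hi)
  · intro i j hij hj
    have hi : i < n := by omega
    simp only [hi, hj, dite_true, hg2]
    exact f.strictMono hij

theorem uniq {G : SimpleGraph V} (hT : G.IsTree) {x y : V} {p q : G.Walk x y} (hp : p.IsPath)
    (hq : q.IsPath) : p = q := by
  have := hT.isAcyclic.path_unique ⟨p, hp⟩ ⟨q, hq⟩
  exact congrArg Subtype.val this

theorem exPath {G : SimpleGraph V} (hT : G.IsTree) (x y : V) : ∃ p : G.Walk x y, p.IsPath := by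
  obtain ⟨w⟩ := hT.connected.preconnected x y
  exact ⟨w.bypass, w.bypass_isPath⟩

noncomputable def tp {G : SimpleGraph V} (hT : G.IsTree) (x y : V) : G.Walk x y :=
  (exPath hT x y).choose

theorem tp_isPath {G : SimpleGraph V} (hT : G.IsTree) (x y : V) : (tp hT x y).IsPath :=
  (exPath hT x y).choose_spec

theorem step {G : SimpleGraph V} (hT : G.IsTree) (r : V) {a b : V} (h : G.Adj a b) :
    tp hT r b = (tp hT r a).concat h ∨ tp hT r a = (tp hT r b).concat h.symm := by
  by_cases hb : b ∈ (tp hT r a).support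
  · right
    rw [← (tp hT r a).take_spec hb]
    rw [uniq hT ((tp_isPath hT r a).takeUntil hb) (tp_isPath hT r b)]
    rw [uniq hT ((tp_isPath hT r a).dropUntil hb) (q := Walk.cons h.symm Walk.nil)
      (by simp [Walk.cons_isPath_iff, h.ne'])]
    rfl
  · left
    exact uniq hT (tp_isPath _ _ _) ((tp_isPath hT r a).concat hb h)

theorem step_edge {G : SimpleGraph V} (hT : G.IsTree) (r : V) {a b : V} (h : G.Adj a b)
    (e : Sym2 V) :
    (e ∈ (tp hT r a).edges ↔ e ∈ (tp hT r b).edges) ↔ e ≠ s(a, b) := by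
  rcases step hT r h with h1 | h1
  · have := (tp_isPath hT r b).isTrail.edges_nodup
    rw [h1, Walk.edges_concat] at this ⊢
    grind
  · have := (tp_isPath hT r a).isTrail.edges_nodup
    rw [h1, Walk.edges_concat, Sym2.eq_swap] at this ⊢
    grind

theorem walk_edge_s11 {G : SimpleGraph V} (hT : G.IsTree) (r : V) {x y : V} (w : G.Walk x y)
    (hw : w.IsPath) (e : Sym2 V) :
    (e ∈ (tp hT r x).edges ↔ e ∈ (tp hT r y).edges) ↔ e ∉ w.edges := by
  induction w with
  | nil => simp
  | cons h p ih =>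
    have h1 := step_edge hT r h e
    have h2 := ih hw.of_cons
    have := hw.isTrail.edges_nodup
    rw [Walk.edges_cons] at this ⊢
    grind

theorem edge_prefix {G : SimpleGraph V} (hT : G.IsTree) (r : V) (e : Sym2 V) (he : e ∈ G.edgeSet) :
    ∃ v, ∀ x, e ∈ (tp hT r x).edges ↔ (tp hT r v).support <+: (tp hT r x).support := by
  have main : ∀ u v, G.Adj u v → (h : G.Adj u v) → tp hT r v = (tp hT r u).concat h → ∀ x,
      s(u,v) ∈ (tp hT r x).edges ↔ (tp hT r v).support <+: (tp hT r x).support := by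
    intro u v _ h hv x
    have key : v ∈ (tp hT r x).support → 
        ∃ q : G.Walk v x, tp hT r x = (tp hT r v).append q := by
      intro hvx
      refine ⟨(tp hT r x).dropUntil v hvx, ?_⟩
      conv_lhs => rw [← (tp hT r x).take_spec hvx]
      rw [uniq hT ((tp_isPath hT r x).takeUntil hvx) (tp_isPath hT r v)]
    constructor
    · intro hx
      obtain ⟨q, hq⟩ := key (Walk.snd_mem_support_of_mem_edges _ hx)
      rw [hq, Walk.support_append]
      exact List.prefix_append _ _
    · intro hx
      obtain ⟨q, hq⟩ := key (hx.subset (Walk.end_mem_support _))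
      rw [hq, hv]
      simp
  induction e using Sym2.ind with
  | _ a b =>
    have h : G.Adj a b := he
    rcases step hT r h with h1 | h1
    · exact ⟨b, main a b h h h1⟩
    · refine ⟨a, ?_⟩
      rw [Sym2.eq_swap]
      exact main b a h.symm h.symm h1

theorem extend [Fintype V] {G : SimpleGraph V} (hT : G.IsTree) (hdeg : ∀ v : V, G.degree v ≠ 2)
    (e f : Sym2 V) {a b : V} (p : G.Walk a b) (hp : p.IsPath) (he : e ∈ p.edges) (hf : f ∉ p.edges)
    (ha : G.degree a ≠ 1) : ∃ (z : V) (q : G.Walk z b), q.IsPath ∧ e ∈ q.edges ∧ f ∉ q.edges ∧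
      q.length = p.length + 1 := by
  have hd : 2 < G.degree a := by
    have h0 : 0 < G.degree a := by
      rw [G.degree_pos_iff_exists_adj]
      cases p with
      | nil => simp at he
      | cons h p => exact ⟨_, h⟩
    have := hdeg a
    omega
  have hw : ∃ w, ∀ z, f = s(z, a) → z = w := by
    by_cases h : ∃ w, f = s(w, a)
    · obtain ⟨w, rfl⟩ := h
      refine ⟨w, fun z hz => ?_⟩
      rw [Sym2.congr_left] at hz
      exact hz.symm
    · exact ⟨a, fun z hz => absurd ⟨z, hz⟩ h⟩
  obtain ⟨w, hw⟩ := hw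
  have hc : ({p.snd, w} : Finset V).card < (G.neighborFinset a).card := by
    rw [G.card_neighborFinset_eq_degree]
    exact lt_of_le_of_lt Finset.card_le_two hd
  obtain ⟨z, hz1, hz2⟩ := Finset.exists_mem_notMem_of_card_lt_card hc
  rw [mem_neighborFinset] at hz1
  simp only [Finset.mem_insert, Finset.mem_singleton, not_or] at hz2
  have hzp : z ∉ p.support := by
    intro hz
    apply hz2.1
    have h1 := Walk.snd_takeUntil hz1.ne' p hz
    rw [uniq hT (hp.takeUntil hz) (q := Walk.cons hz1 Walk.nil)
      (by simp [Walk.cons_isPath_iff, hz1.ne])] at h1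
    simpa using h1
  refine ⟨z, Walk.cons hz1.symm p, hp.cons hzp, by simp [he], ?_, by simp⟩
  rw [Walk.edges_cons, List.mem_cons, not_or]
  exact ⟨fun h => hz2.2 (hw z h), hf⟩

theorem leafPath [Fintype V] {G : SimpleGraph V} (hT : G.IsTree) (hdeg : ∀ v : V, G.degree v ≠ 2)
    (e f : Sym2 V) (n : ℕ) : ∀ {a b : V} (p : G.Walk a b), p.IsPath → e ∈ p.edges → f ∉ p.edges →
    Fintype.card V ≤ p.length + n →
    ∃ (x y : V) (q : G.Walk x y), G.degree x = 1 ∧ G.degree y = 1 ∧ q.IsPath ∧ e ∈ q.edges ∧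
      f ∉ q.edges := by
  induction n with
  | zero => intro a b p hp _ _ h; have := hp.length_lt; omega
  | succ n ih =>
    intro a b p hp he hf hn
    by_cases ha : G.degree a = 1
    · by_cases hb : G.degree b = 1
      · exact ⟨a, b, p, ha, hb, hp, he, hf⟩
      · obtain ⟨z, q, h1, h2, h3, h4⟩ := extend hT hdeg e f p.reverse hp.reverse
          (by simpa using he) (by simpa using hf) hb
        rw [Walk.length_reverse] at h4
        exact ih q h1 h2 h3 (by omega)
    · obtain ⟨z, q, h1, h2, h3, h4⟩ := extend hT hdeg e f p hp he hf ha
      exact ih q h1 h2 h3 (by omega)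

theorem leafPath' [Fintype V] {G : SimpleGraph V} (hT : G.IsTree) (hdeg : ∀ v : V, G.degree v ≠ 2)
    (e f : Sym2 V) (he : e ∈ G.edgeSet) (hef : e ≠ f) (r : V) :
    ∃ x y : V, G.degree x = 1 ∧ G.degree y = 1 ∧
      ¬ (e ∈ (tp hT r x).edges ↔ e ∈ (tp hT r y).edges) ∧
      (f ∈ (tp hT r x).edges ↔ f ∈ (tp hT r y).edges) := by
  induction e using Sym2.ind with
  | _ a b =>
    have h : G.Adj a b := he
    obtain ⟨x, y, q, hx, hy, hq, h1, h2⟩ := leafPath hT hdeg s(a,b) f (Fintype.card V)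
      (Walk.cons h Walk.nil) (by simp [Walk.cons_isPath_iff, h.ne]) (by simp)
      (by simpa using hef.symm) (by omega)
    refine ⟨x, y, hx, hy, ?_, ?_⟩
    · rw [walk_edge_s11 hT r q hq]; simpa using h1
    · rw [walk_edge_s11 hT r q hq]; exact h2

theorem stmt11 [Fintype V] (G : SimpleGraph V) (hT : G.IsTree)
    (hdeg : ∀ v : V, G.degree v ≠ 2) (hcard : 3 ≤ Fintype.card V)
    (k : ℕ) (hk : 1 ≤ k) (hleaves : leafCount G = 3 * k) :
    ∃ F : Set (PathIn G), F.Finite ∧ F.ncard = 2 * k ∧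
      EdgeSep G F ∧ EdgeCover G F := by
  obtain ⟨r⟩ : Nonempty V := Fintype.card_pos_iff.1 (by omega)
  let ix : V → ℕ := fun x => (Fintype.equivFin V x : ℕ)
  have hix : Function.Injective ix := fun x y h =>
    (Fintype.equivFin V).injective (Fin.ext h)
  let key : V → List ℕ := fun x => (tp hT r x).support.map ix
  have hkey : Function.Injective key := by
    intro x y h
    have h' : (tp hT r x).support = (tp hT r y).support := List.map_injective_iff.2 hix h
    have hx := (tp hT r x).getLast_support
    have hy := (tp hT r y).getLast_support
    rw [← hx, ← hy]
    congr 1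
  obtain ⟨l, hl1, hl2, hl3⟩ := enum (Finset.univ.filter fun x : V => G.degree x = 1) (3 * k)
    (by
      rw [← hleaves, leafCount, Nat.card_eq_fintype_card, Fintype.card_subtype]
      rfl) key hkey r
  have linj : ∀ i j, i < 3 * k → j < 3 * k → l i = l j → i = j := by
    intro i j hi hj h
    rcases lt_trichotomy i j with h' | h' | h'
    · have := hl3 i j h' hj
      rw [h] at this; exact absurd this (lt_irrefl _)
    · exact h'
    · have := hl3 j i h' hi
      rw [h] at this; exact absurd this (lt_irrefl _)
  let S : Sym2 V → ℕ → Prop := fun e i => e ∈ (tp hT r (l i)).edges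
  have conv : ∀ e ∈ G.edgeSet, ∀ i j m, i < j → j < m → m < 3 * k → S e i → S e m → S e j := by
    intro e he i j m hij hjm hm h1 h2
    obtain ⟨v, hv⟩ := edge_prefix hT r e he
    have hv' : ∀ i, S e i ↔ key v <+: key (l i) := fun i => by
      simp only [S, hv, key]
      exact (List.prefix_map_iff_of_injective hix).symm
    rw [hv'] at *
    exact prefix_convex _ _ _ _ (hl3 i j hij (by omega)) (hl3 j m hjm hm) h1 h2
  let P : ℕ → ℕ → PathIn G := fun i j => ⟨l i, l j, tp hT (l i) (l j), tp_isPath _ _ _⟩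
  have hP : ∀ e i j, PathIn.emem e (P i j) ↔ ¬ (S e i ↔ S e j) := by
    intro e i j
    have := walk_edge_s11 hT r (tp hT (l i) (l j)) (tp_isPath _ _ _) e
    simp only [S, this, not_not]
    rfl
  have Pinj : ∀ i j i' j', i < 3 * k → j < 3 * k → i' < 3 * k → j' < 3 * k → P i j = P i' j' →
      i = i' ∧ j = j' := by
    intro i j i' j' h1 h2 h3 h4 h
    exact ⟨linj _ _ h1 h3 (congrArg (fun Q : PathIn G => Q.1) h),
      linj _ _ h2 h4 (congrArg (fun Q : PathIn G => Q.2.1) h)⟩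
  let g : ℕ → PathIn G := fun j => if j < k then P j (j + k) else P (j - k) (j + k)
  have ginj : Set.InjOn g (Set.Iio (2 * k)) := by
    intro i hi j hj h
    simp only [Set.mem_Iio] at hi hj
    simp only [g] at h
    split_ifs at h <;>
    · have := Pinj _ _ _ _ (by omega) (by omega) (by omega) (by omega) h
      omega
  have g1 : ∀ i < k, P i (i + k) ∈ g '' Set.Iio (2 * k) := fun i hi =>
    ⟨i, by simp only [Set.mem_Iio]; omega, by simp [g, hi]⟩
  have g2 : ∀ i < k, P i (i + 2 * k) ∈ g '' Set.Iio (2 * k) := fun i hi =>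
    ⟨i + k, by simp only [Set.mem_Iio]; omega, by simp [g]; congr 1; omega⟩
  refine ⟨g '' Set.Iio (2 * k), (Set.finite_Iio _).image _, ?_, ?_, ?_⟩
  · rw [Set.ncard_image_of_injOn ginj]
    simp [Set.ncard_eq_toFinset_card']
  · intro e he f hf hef
    by_contra hcon
    push Not at hcon
    have hc : ∀ Q ∈ g '' Set.Iio (2 * k), (PathIn.emem e Q ↔ PathIn.emem f Q) := by
      intro Q hQ
      have := hcon Q hQ
      tauto
    have all := comb k (S e) (S f) (conv e he) (conv f hf)
      (fun i hi => by have := hc _ (g1 i hi); rw [hP, hP] at this; tauto)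
      (fun i hi => by have := hc _ (g2 i hi); rw [hP, hP] at this; tauto)
    obtain ⟨x, y, hx, hy, h1, h2⟩ := leafPath' hT hdeg e f he hef r
    obtain ⟨i, hi, rfl⟩ := hl2 x (by simp [hx])
    obtain ⟨j, hj, rfl⟩ := hl2 y (by simp [hy])
    have := all i j hi hj
    simp only [S] at this
    tauto
  · intro e he
    by_contra hcon
    push Not at hcon
    have all := comb k (S e) (fun _ => False) (conv e he) (by tauto)
      (fun i hi => by have := hcon _ (g1 i hi); rw [hP] at this; tauto)
      (fun i hi => by have := hcon _ (g2 i hi); rw [hP] at this; tauto)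
    obtain ⟨x, y, hx, hy, h1, h2⟩ := leafPath' hT hdeg e s(r, r) he
      (by rintro rfl; simp at he) r
    obtain ⟨i, hi, rfl⟩ := hl2 x (by simp [hx])
    obtain ⟨j, hj, rfl⟩ := hl2 y (by simp [hy])
    have := all i j hi hj
    simp only [S] at this
    tauto
end

section
/- Let T be a tree with no degree-2 vertices and with at least two bunches of leaves, each bunch of size at least three. Then the minimum size of a family of paths separating and covering V(T) equals ⌈2h₁(T)/3⌉. -/
open SimpleGraph
open scoped Classical

universe u

variable {V : Type u}

namespace TreeSep

/-! ### Paths in trees -/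

/-- The unique path in a tree. -/
noncomputable def tp {G : SimpleGraph V} (hT : G.IsTree) (a b : V) : G.Walk a b :=
  (hT.existsUnique_path a b).choose

lemma tp_isPath {G : SimpleGraph V} (hT : G.IsTree) (a b : V) : (tp hT a b).IsPath :=
  (hT.existsUnique_path a b).choose_spec.1

lemma eq_tp {G : SimpleGraph V} (hT : G.IsTree) {a b : V} {p : G.Walk a b} (hp : p.IsPath) :
    p = tp hT a b :=
  (hT.existsUnique_path a b).choose_spec.2 p hp

lemma tp_rev {G : SimpleGraph V} (hT : G.IsTree) (a b : V) :
    (tp hT a b).reverse = tp hT b a :=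
  eq_tp hT (tp_isPath hT a b).reverse

lemma mem_tp_comm {G : SimpleGraph V} (hT : G.IsTree) {a b x : V} :
    x ∈ (tp hT a b).support ↔ x ∈ (tp hT b a).support := by
  rw [← tp_rev hT a b, Walk.support_reverse, List.mem_reverse]

lemma path_split {G : SimpleGraph V} (hT : G.IsTree) {a b x : V} {p : G.Walk a b}
    (hp : p.IsPath) (hx : x ∈ p.support) : p = (tp hT a x).append (tp hT x b) := by
  rw [← eq_tp hT (hp.takeUntil hx), ← eq_tp hT (hp.dropUntil hx), Walk.take_spec]

lemma tp_subset {G : SimpleGraph V} (hT : G.IsTree) {a b v w y : V} {p : G.Walk a b}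
    (hp : p.IsPath) (hv : v ∈ p.support) (hw : w ∈ p.support)
    (hy : y ∈ (tp hT v w).support) : y ∈ p.support := by
  have h := path_split hT hp hv
  rw [h] at hw ⊢
  rw [Walk.mem_support_append_iff] at hw ⊢
  rcases hw with hw | hw
  · left
    rw [path_split hT (tp_isPath hT a v) hw, Walk.mem_support_append_iff]
    right
    exact (mem_tp_comm hT).1 hy
  · right
    rw [path_split hT (tp_isPath hT v b) hw, Walk.mem_support_append_iff]
    left; exact hy

/-- The neighbour of `v` in the direction of `x`. -/
noncomputable def col {G : SimpleGraph V} (hT : G.IsTree) (v x : V) : V := (tp hT v x).snd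

lemma col_adj {G : SimpleGraph V} (hT : G.IsTree) {v x : V} (h : x ≠ v) :
    G.Adj v (col hT v x) :=
  Walk.adj_snd (Walk.not_nil_of_ne h.symm)

lemma col_mem {G : SimpleGraph V} (hT : G.IsTree) (v x : V) :
    col hT v x ∈ (tp hT v x).support := Walk.getVert_mem_support _ _

lemma tp_adj {G : SimpleGraph V} (hT : G.IsTree) {v u : V} (h : G.Adj v u) :
    tp hT v u = Walk.cons h Walk.nil := by
  symm; apply eq_tp
  simp [h.ne]

lemma adj_mem {G : SimpleGraph V} (hT : G.IsTree) {v u x : V} (h : G.Adj v u)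
    (hu : u ∈ (tp hT v x).support) : col hT v x = u := by
  rw [col, path_split hT (tp_isPath hT v x) hu, tp_adj hT h]
  simp [Walk.snd]

lemma col_of_adj {G : SimpleGraph V} (hT : G.IsTree) {v u : V} (h : G.Adj v u) :
    col hT v u = u := adj_mem hT h (Walk.end_mem_support _)

lemma col_eq_of_mem {G : SimpleGraph V} (hT : G.IsTree) {v x y : V} (hy : y ≠ v)
    (h : y ∈ (tp hT v x).support) : col hT v x = col hT v y := by
  apply adj_mem hT (col_adj hT hy)
  exact tp_subset hT (tp_isPath hT v x) (Walk.start_mem_support _) h (col_mem hT v y)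

lemma tp_concat {G : SimpleGraph V} (hT : G.IsTree) {v x y : V} (h : G.Adj x y)
    (hy : y ∉ (tp hT v x).support) : (tp hT v x).concat h = tp hT v y :=
  eq_tp hT ((tp_isPath hT v x).concat hy h)

lemma mem_of_not_mem {G : SimpleGraph V} (hT : G.IsTree) {v x y : V} (h : G.Adj x y)
    (hy : y ∉ (tp hT v x).support) : x ∈ (tp hT v y).support := by
  rw [← tp_concat hT h hy]; simp [Walk.support_concat]

lemma col_eq_of_adj {G : SimpleGraph V} (hT : G.IsTree) {v x y : V} (h : G.Adj x y)
    (hx : x ≠ v) (hy : y ≠ v) : col hT v x = col hT v y := by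
  by_cases hm : y ∈ (tp hT v x).support
  · exact col_eq_of_mem hT hy hm
  · exact (col_eq_of_mem hT hx (mem_of_not_mem hT h hm)).symm

lemma col_eq_of_walk {G : SimpleGraph V} (hT : G.IsTree) {v x y : V} (p : G.Walk x y)
    (hv : v ∉ p.support) : col hT v x = col hT v y := by
  induction p with
  | nil => rfl
  | cons h p ih =>
    simp only [Walk.support_cons, List.mem_cons, not_or] at hv
    rw [← ih hv.2]
    refine col_eq_of_adj hT h (Ne.symm hv.1) ?_
    rintro rfl
    exact hv.2 (Walk.start_mem_support _)

lemma mem_of_col_ne {G : SimpleGraph V} (hT : G.IsTree) {v x y : V}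
    (h : col hT v x ≠ col hT v y) : v ∈ (tp hT x y).support := by
  by_contra hv
  exact h (col_eq_of_walk hT _ hv)

lemma not_mem_of_col_eq {G : SimpleGraph V} (hT : G.IsTree) {v x y : V} (hx : x ≠ v)
    (hy : y ≠ v) (h : col hT v x = col hT v y) : v ∉ (tp hT x y).support := by
  intro hv
  have hs := path_split hT (tp_isPath hT x y) hv
  have hn := (tp_isPath hT x y).support_nodup
  rw [hs, Walk.support_append, List.nodup_append] at hn
  refine hn.2.2 (col hT v x) ((mem_tp_comm hT).1 (col_mem hT v x)) (col hT v y) ?_ h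
  have := col_mem hT v y
  rw [Walk.mem_support_iff] at this
  exact this.resolve_left (col_adj hT hy).ne'

/-- Neighbours of `v` on a path through `v` lie in the direction of an endpoint. -/
lemma nbr_mem {G : SimpleGraph V} (hT : G.IsTree) {v u x y : V} (hv : v ∈ (tp hT x y).support)
    (hu : G.Adj v u) (h : u ∈ (tp hT x y).support) : col hT v x = u ∨ col hT v y = u := by
  rw [path_split hT (tp_isPath hT x y) hv, Walk.mem_support_append_iff] at h
  rcases h with h | h
  · exact Or.inl (adj_mem hT hu ((mem_tp_comm hT).1 h))
  · exact Or.inr (adj_mem hT hu h)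

/-- Child branches are descendant sets. -/
lemma col_eq_child_iff {G : SimpleGraph V} (hT : G.IsTree) {r v u x : V} (hr : r ≠ v)
    (hx : x ≠ v) (hu : G.Adj v u) (hup : u ≠ col hT v r) :
    col hT v x = u ↔ u ∈ (tp hT r x).support := by
  constructor
  · rintro rfl
    have hv := mem_of_col_ne hT (Ne.symm hup)
    exact tp_subset hT (tp_isPath hT r x) hv (Walk.end_mem_support _) (col_mem hT v x)
  · intro h
    have hc : col hT v r ≠ col hT v u := by rw [col_of_adj hT hu]; exact hup.symm
    have hvu := mem_of_col_ne hT hc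
    have hv : v ∈ (tp hT r x).support :=
      tp_subset hT (tp_isPath hT r x) (Walk.start_mem_support _) h hvu
    exact (nbr_mem hT hv hu h).resolve_left (Ne.symm hup)

lemma col_ne_parent_iff {G : SimpleGraph V} (hT : G.IsTree) {r v x : V} (hr : r ≠ v)
    (hx : x ≠ v) : col hT v x ≠ col hT v r ↔ v ∈ (tp hT r x).support := by
  constructor
  · intro h; exact mem_of_col_ne hT (Ne.symm h)
  · intro h h2; exact not_mem_of_col_eq hT hr hx h2.symm h

/-! ### The depth-first order -/

lemma prefix_convex (P : List ℕ) : ∀ L M N : List ℕ, P <+: L → P <+: N → L ≤ M → M ≤ N →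
    P <+: M := by
  induction P with
  | nil => intro L M N _ _ _ _; exact List.nil_prefix
  | cons a P ih =>
    intro L M N hL hN h1 h2
    obtain ⟨L', rfl⟩ := hL
    obtain ⟨N', rfl⟩ := hN
    cases M with
    | nil => exact absurd h1 (not_le_of_gt (List.nil_lt_cons _ _))
    | cons b M =>
      rw [List.cons_append] at h1 h2
      have h1' : a < b ∨ a = b ∧ P ++ L' ≤ M := by
        rcases lt_trichotomy a b with h | h | h
        · exact Or.inl h
        · subst h
          right
          refine ⟨rfl, le_of_not_gt fun hh => not_lt_of_ge h1 (List.cons_lt_cons_iff.2 (Or.inr ⟨rfl, hh⟩))⟩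
        · exact absurd (List.cons_lt_cons_iff.2 (Or.inl h)) (not_lt_of_ge h1)
      have h2' : b < a ∨ b = a ∧ M ≤ P ++ N' := by
        rcases lt_trichotomy b a with h | h | h
        · exact Or.inl h
        · subst h
          right
          refine ⟨rfl, le_of_not_gt fun hh => not_lt_of_ge h2 (List.cons_lt_cons_iff.2 (Or.inr ⟨rfl, hh⟩))⟩
        · exact absurd (List.cons_lt_cons_iff.2 (Or.inl h)) (not_lt_of_ge h2)
      have hab : a = b := by omega
      subst hab
      have := ih _ M _ (List.prefix_append P L') (List.prefix_append P N')
        (by simpa using h1') (by simpa using h2')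
      exact (List.prefix_cons_inj a).2 this

lemma exists_enum {S : Type*} [Fintype S] (key : S → List ℕ) (hinj : Function.Injective key)
    {n : ℕ} (h : Fintype.card S = n) :
    ∃ e : Fin n ≃ S, ∀ i j, i ≤ j → key (e i) ≤ key (e j) := by
  letI : LinearOrder S := LinearOrder.lift' key hinj
  refine ⟨(monoEquivOfFin S h).toEquiv, fun i j hij => ?_⟩
  exact (monoEquivOfFin S h).monotone hij

lemma exists_order [Fintype V] {G : SimpleGraph V} (hT : G.IsTree) (r : V) (S : Set V) {n : ℕ}
    (hS : Fintype.card S = n) : ∃ e : Fin n ≃ S, ∀ w : V, ∀ i j k : Fin n, i ≤ j → j ≤ k →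
      w ∈ (tp hT r (e i)).support → w ∈ (tp hT r (e k)).support →
      w ∈ (tp hT r (e j)).support := by
  let f : V → ℕ := fun v => (Fintype.equivFin V v : ℕ)
  have hf : Function.Injective f := fun a b h => (Fintype.equivFin V).injective (Fin.ext h)
  let key0 : V → List ℕ := fun x => (tp hT r x).support.map f
  have hpre : ∀ w x, w ∈ (tp hT r x).support ↔ key0 w <+: key0 x := by
    intro w x
    constructor
    · intro h
      simp only [key0]
      rw [path_split hT (tp_isPath hT r x) h, Walk.support_append, List.map_append]
      exact List.prefix_append _ _
    · intro h
      have h1 : f w ∈ key0 w := List.mem_map_of_mem (Walk.end_mem_support _)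
      have h2 := h.subset h1
      obtain ⟨z, hz, hzw⟩ := List.mem_map.1 h2
      rwa [← hf hzw]
  have hinj : Function.Injective key0 := by
    intro x y h
    have h1 : x ∈ (tp hT r y).support := (hpre x y).2 (h ▸ List.prefix_refl _)
    have h2 : (tp hT r x).support = (tp hT r y).support := List.map_injective_iff.2 hf h
    have h3 := path_split hT (tp_isPath hT r y) h1
    have h4 := congrArg Walk.length h3
    have h5 := congrArg List.length h2
    simp only [Walk.length_append, Walk.length_support] at h4 h5
    exact Walk.eq_of_length_eq_zero (p := tp hT x y) (by omega)
  obtain ⟨e, he⟩ := exists_enum (fun s : S => key0 s) (hinj.comp Subtype.val_injective) hS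
  refine ⟨e, fun w i j k hij hjk h1 h2 => ?_⟩
  rw [hpre] at h1 h2 ⊢
  exact prefix_convex _ _ _ _ h1 h2 (he i j hij) (he j k hjk)

/-! ### The cyclic permutation of the bunch centres -/

lemma const_of_step {α : Type*} (g : ℕ → α) (p q : ℕ) (hpq : p ≤ q)
    (h : ∀ i, p ≤ i → i < q → g i = g (i + 1)) : g p = g q := by
  induction q, hpq using Nat.le_induction with
  | base => rfl
  | succ k hk ih =>
    rw [ih (fun i h1 h2 => h i h1 (by omega)), h k hk (by omega)]

lemma arc_step {α : Type*} {n : ℕ} (A : ℕ → Prop) (g : ℕ → α)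
    (hconv : (∀ i j k, i ≤ j → j ≤ k → k < n → A i → A k → A j) ∨
      (∀ i j k, i ≤ j → j ≤ k → k < n → ¬ A i → ¬ A k → ¬ A j))
    {p q : ℕ} (hpq : p < q) (hq : q < n) (hAp : ¬ A p) (hAq : ¬ A q) (hg : g p ≠ g q) :
    ∃ i < n, ¬ A i ∧ ¬ A ((i + 1) % n) ∧ g i ≠ g ((i + 1) % n) := by
  by_contra hcon
  push Not at hcon
  have hstep : ∀ i, i + 1 < n → ¬ A i → ¬ A (i + 1) → g i = g (i + 1) := by
    intro i hi h1 h2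
    have := hcon i (by omega)
    rw [Nat.mod_eq_of_lt hi] at this
    exact this h1 h2
  by_cases hint : ∀ i, p ≤ i → i ≤ q → ¬ A i
  · apply hg
    apply const_of_step g p q hpq.le
    intro i h1 h2
    exact hstep i (by omega) (hint i h1 h2.le) (hint (i + 1) (by omega) (by omega))
  · push Not at hint
    obtain ⟨a, h1, h2, ha⟩ := hint
    rcases hconv with hc | hc
    · have hlo : ∀ i, i ≤ p → ¬ A i := fun i hi hA => hAp (hc i p a hi h1 (by omega) hA ha)
      have hhi : ∀ i, q ≤ i → i < n → ¬ A i := fun i hi hin hA => hAq (hc a q i h2 hi hin ha hA)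
      have e1 : g 0 = g p := const_of_step g 0 p (by omega) fun i _ hi =>
        hstep i (by omega) (hlo _ (by omega)) (hlo _ (by omega))
      have e2 : g q = g (n - 1) := const_of_step g q (n - 1) (by omega) fun i _ hi =>
        hstep i (by omega) (hhi _ (by omega) (by omega)) (hhi _ (by omega) (by omega))
      have e3 := hcon (n - 1) (by omega) (hhi _ (by omega) (by omega))
      have hz : (n - 1 + 1) % n = 0 := by
        rw [Nat.sub_add_cancel (by omega)]; exact Nat.mod_self n
      rw [hz] at e3
      exact hg (by rw [← e1, e2, e3 (hlo 0 (by omega))])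
    · exact hc p a q h1 h2 hq hAp hAq ha

lemma arc_step' {α : Type*} {n : ℕ} (A : ℕ → Prop) (g : ℕ → α)
    (hconv : (∀ i j k, i ≤ j → j ≤ k → k < n → A i → A k → A j) ∨
      (∀ i j k, i ≤ j → j ≤ k → k < n → ¬ A i → ¬ A k → ¬ A j))
    {p q : ℕ} (hp : p < n) (hq : q < n) (hAp : ¬ A p) (hAq : ¬ A q) (hg : g p ≠ g q) :
    ∃ i < n, ¬ A i ∧ ¬ A ((i + 1) % n) ∧ g i ≠ g ((i + 1) % n) := by
  rcases lt_trichotomy p q with h | h | h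
  · exact arc_step A g hconv h hq hAp hAq hg
  · subst h; exact absurd rfl hg
  · exact arc_step A g hconv h hp hAq hAp hg.symm

lemma exists_nbr_ne_ne [Fintype V] {G : SimpleGraph V} {v : V} (h : 3 ≤ G.degree v) (a b : V) :
    ∃ w, G.Adj v w ∧ w ≠ a ∧ w ≠ b := by
  have h1 : (({a, b} : Finset V)).card < (G.neighborFinset v).card := by
    rw [G.card_neighborFinset_eq_degree]
    exact lt_of_le_of_lt Finset.card_le_two (by omega)
  obtain ⟨w, hw, hw2⟩ := Finset.exists_mem_notMem_of_card_lt_card h1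
  simp only [Finset.mem_insert, Finset.mem_singleton, not_or] at hw2
  exact ⟨w, (G.mem_neighborFinset v w).1 hw, hw2.1, hw2.2⟩

lemma exists_perm [Fintype V] {G : SimpleGraph V} (hT : G.IsTree) (S : Set V)
    (hS : 2 ≤ Fintype.card S) (Q : V → Prop) (hQS : ∀ v, Q v → v ∉ S)
    (hQ : ∀ v, Q v → 3 ≤ G.degree v)
    (hbr : ∀ v, Q v → ∀ u, G.Adj v u → ∃ s ∈ S, col hT v s = u) :
    ∃ σ : Equiv.Perm S, (∀ s, σ s ≠ s) ∧ ∀ v, Q v → ∀ u, G.Adj v u →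
      ∃ s : S, col hT v s ≠ u ∧ col hT v (σ s) ≠ u ∧ col hT v s ≠ col hT v (σ s) := by
  obtain ⟨n, hn⟩ : ∃ n, Fintype.card S = n := ⟨_, rfl⟩
  have hn2 : 2 ≤ n := hn ▸ hS
  haveI : NeZero n := ⟨by omega⟩
  obtain ⟨⟨r, hrS⟩⟩ : Nonempty S := Fintype.card_pos_iff.1 (by omega)
  obtain ⟨e, he⟩ := exists_order hT r S hn
  let σ : Equiv.Perm S := (e.symm.trans (finRotate n)).trans e
  have hσ : ∀ i : Fin n, σ (e i) = e ⟨(i + 1) % n, Nat.mod_lt _ (by omega)⟩ := by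
    intro i
    simp only [σ, Equiv.trans_apply, Equiv.symm_apply_apply, finRotate_apply]
    congr 1
    apply Fin.ext
    simp [Fin.val_add]
  refine ⟨σ, ?_, ?_⟩
  · intro s
    obtain ⟨i, rfl⟩ := e.surjective s
    rw [hσ]
    intro h
    have h1 := congrArg Fin.val (e.injective h)
    simp only at h1
    have := i.2
    by_cases hi : (i : ℕ) + 1 < n
    · rw [Nat.mod_eq_of_lt hi] at h1; omega
    · have : (i : ℕ) + 1 = n := by omega
      rw [this, Nat.mod_self] at h1; omega
  · intro v hv u hu
    have hne : ∀ s ∈ S, s ≠ v := fun s hs h => hQS v hv (h ▸ hs)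
    have hrv := hne r hrS
    let x : ℕ → V := fun i => (e (Fin.ofNat n i) : V)
    have hxS : ∀ i, x i ∈ S := fun i => (e _).2
    have hx : ∀ i (h : i < n), x i = e ⟨i, h⟩ := by
      intro i h
      simp only [x]
      congr 2
      apply Fin.ext
      simp [Fin.ofNat, Nat.mod_eq_of_lt h]
    have hconvx : ∀ w i j k, i ≤ j → j ≤ k → k < n → w ∈ (tp hT r (x i)).support →
        w ∈ (tp hT r (x k)).support → w ∈ (tp hT r (x j)).support := by
      intro w i j k hij hjk hk
      rw [hx i (by omega), hx j (by omega), hx k hk]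
      exact he w _ _ _ hij hjk
    have hidx : ∀ s ∈ S, ∃ i < n, x i = s := by
      intro s hs
      refine ⟨e.symm ⟨s, hs⟩, (e.symm ⟨s, hs⟩).2, ?_⟩
      rw [hx _ (e.symm ⟨s, hs⟩).2]; simp
    let A : ℕ → Prop := fun i => col hT v (x i) = u
    have hconv : (∀ i j k, i ≤ j → j ≤ k → k < n → A i → A k → A j) ∨
      (∀ i j k, i ≤ j → j ≤ k → k < n → ¬ A i → ¬ A k → ¬ A j) := by
      by_cases hup : u = col hT v r
      · right
        intro i j k hij hjk hk
        simp only [A]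
        rw [hup]
        have := fun i => col_ne_parent_iff hT hrv (hne _ (hxS i))
        simp only [ne_eq] at this
        rw [this, this, this]
        exact hconvx v i j k hij hjk hk
      · left
        intro i j k hij hjk hk
        simp only [A]
        have := fun i => col_eq_child_iff hT hrv (hne _ (hxS i)) hu hup
        rw [this, this, this]
        exact hconvx u i j k hij hjk hk
    obtain ⟨w1, hw1, hw1u, _⟩ := exists_nbr_ne_ne (hQ v hv) u u
    obtain ⟨w2, hw2, hw2u, hw12⟩ := exists_nbr_ne_ne (hQ v hv) u w1
    obtain ⟨s1, hs1, hc1⟩ := hbr v hv w1 hw1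
    obtain ⟨s2, hs2, hc2⟩ := hbr v hv w2 hw2
    obtain ⟨p, hp, rfl⟩ := hidx s1 hs1
    obtain ⟨q, hq, rfl⟩ := hidx s2 hs2
    obtain ⟨i, hi, h1, h2, h3⟩ := arc_step' A (fun i => col hT v (x i)) hconv hp hq
      (by simp only [A]; rw [hc1]; exact hw1u) (by simp only [A]; rw [hc2]; exact hw2u)
      (by rw [hc1, hc2]; exact hw12.symm)
    refine ⟨e ⟨i, hi⟩, ?_⟩
    rw [hσ]
    simp only [A] at h1 h2 h3
    rw [hx _ hi] at h1 h3
    rw [hx _ (Nat.mod_lt _ (by omega))] at h2 h3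
    exact ⟨h1, h2, h3⟩

/-- Every branch contains a bunch centre. -/
lemma branch_leaf [Fintype V] {G : SimpleGraph V} (hT : G.IsTree) {v u : V} (hu : G.Adj v u) :
    ∃ x, x ≠ v ∧ col hT v x = u ∧ G.degree x = 1 := by
  let B : Finset V := Finset.univ.filter fun x => x ≠ v ∧ col hT v x = u
  have hB : B.Nonempty := ⟨u, by simp [B, hu.ne', col_of_adj hT hu]⟩
  obtain ⟨x, hxB, hmax⟩ := B.exists_max_image (fun x => (tp hT v x).length) hB
  simp only [B, Finset.mem_filter, Finset.mem_univ, true_and] at hxB hmax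
  refine ⟨x, hxB.1, hxB.2, ?_⟩
  rw [degree_eq_one_iff_existsUnique_adj]
  refine ⟨col hT x v, col_adj hT hxB.1.symm, ?_⟩
  intro y hy
  by_cases hm : y ∈ (tp hT v x).support
  · exact (adj_mem hT hy ((mem_tp_comm hT).1 hm)).symm
  · exfalso
    have hyv : y ≠ v := by rintro rfl; exact hm (Walk.start_mem_support _)
    have h1 := hmax y ⟨hyv, by rw [← col_eq_of_adj hT hy hxB.1 hyv]; exact hxB.2⟩
    rw [← tp_concat hT hy hm, Walk.length_concat] at h1
    omega

/-! ### Leaves -/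

lemma leaf_unique [Fintype V] {G : SimpleGraph V} {x a b : V} (hx : G.degree x = 1)
    (ha : G.Adj x a) (hb : G.Adj x b) : a = b :=
  (degree_eq_one_iff_existsUnique_adj.1 hx).unique ha hb

lemma leaf_end [Fintype V] {G : SimpleGraph V} (hT : G.IsTree) {x : V} (hx : G.degree x = 1)
    {a b : V} {p : G.Walk a b} (hp : p.IsPath) (h : x ∈ p.support) : x = a ∨ x = b := by
  by_contra hcon
  push Not at hcon
  rw [eq_tp hT hp] at h
  refine not_mem_of_col_eq hT hcon.1.symm hcon.2.symm ?_ h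
  exact leaf_unique hx (col_adj hT hcon.1.symm) (col_adj hT hcon.2.symm)

lemma leaf_nbr_mem [Fintype V] {G : SimpleGraph V} (hT : G.IsTree) {x s y : V}
    (hx : G.degree x = 1) (hs : G.Adj x s) (hy : y ≠ x) : s ∈ (tp hT x y).support := by
  rw [leaf_unique hx hs (col_adj hT hy)]
  exact col_mem hT x y

/-! ### Lower bound -/

lemma lower [Fintype V] {G : SimpleGraph V} (hT : G.IsTree) (F : Finset (PathIn G))
    (hsep : VertexSep G (F : Set (PathIn G))) (hcov : VertexCover G (F : Set (PathIn G))) :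
    (2 * leafCount G + 2) / 3 ≤ F.card := by
  let L : Finset V := Finset.univ.filter fun x => G.degree x = 1
  have hL : leafCount G = L.card := by
    simp [leafCount, L, Fintype.card_subtype]
  have hLm : ∀ x ∈ L, G.degree x = 1 := fun x hx => by simpa [L] using hx
  let f : V → Finset (PathIn G) := fun x => F.filter fun P => PathIn.vmem x P
  have h1 : ∀ x ∈ L, 2 ≤ (f x).card + (if (f x).card = 1 then 1 else 0) := by
    intro x _
    obtain ⟨P, hP, hxP⟩ := hcov x
    have : 0 < (f x).card := Finset.card_pos.2 ⟨P, by simpa [f] using ⟨hP, hxP⟩⟩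
    split_ifs <;> omega
  have h2 : ∑ x ∈ L, (f x).card ≤ 2 * F.card := by
    have : ∑ x ∈ L, (f x).card = ∑ P ∈ F, (L.filter fun x => PathIn.vmem x P).card :=
      Finset.sum_card_bipartiteAbove_eq_sum_card_bipartiteBelow (fun x P => PathIn.vmem x P)
    rw [this, mul_comm]
    apply Finset.sum_le_card_nsmul
    intro P _
    refine le_trans (Finset.card_le_card (t := {P.1, P.2.1}) ?_) Finset.card_le_two
    intro x hx
    rw [Finset.mem_filter] at hx
    simpa using leaf_end hT (hLm x hx.1) P.2.2.2 hx.2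
  have h3 : (L.filter fun x => (f x).card = 1).card ≤ F.card := by
    have hch : ∀ x, ∃ P, (f x).card = 1 → f x = {P} := by
      intro x
      by_cases h : (f x).card = 1
      · obtain ⟨P, hP⟩ := Finset.card_eq_one.1 h
        exact ⟨P, fun _ => hP⟩
      · obtain ⟨P, _⟩ := hcov x
        exact ⟨P, fun h' => absurd h' h⟩
    choose g hg using hch
    apply Finset.card_le_card_of_injOn g
    · intro x hx
      have hx := (Finset.mem_filter.1 hx).2
      have : g x ∈ f x := by rw [hg x hx]; simp
      exact (Finset.mem_filter.1 this).1
    · intro x hx y hy hxy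
      have hx := (Finset.mem_filter.1 hx).2
      have hy := (Finset.mem_filter.1 hy).2
      by_contra hne
      have hfe : f x = f y := by rw [hg x hx, hg y hy, hxy]
      obtain ⟨P, hP, hs⟩ := hsep x y hne
      have hiff : P ∈ f x ↔ P ∈ f y := by rw [hfe]
      have hPF : P ∈ F := hP
      simp only [f, Finset.mem_filter, hPF, true_and] at hiff
      tauto
  have h4 := Finset.sum_le_sum h1
  rw [Finset.sum_add_distrib, ← Finset.card_filter] at h4
  simp only [Finset.sum_const, smul_eq_mul] at h4
  rw [hL]
  omega

/-! ### Families that are good for the leaves -/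

/-- `F` covers and separates the leaves in `A`, and meets no other leaves. -/
def Good [Fintype V] (G : SimpleGraph V) (A : Finset V) (F : Finset (PathIn G)) : Prop :=
  (∀ x ∈ A, ∃ P ∈ F, PathIn.vmem x P) ∧
  (∀ P ∈ F, ∀ x, G.degree x = 1 → PathIn.vmem x P → x ∈ A) ∧
  (∀ x ∈ A, ∀ y ∈ A, x ≠ y → ∃ P ∈ F,
    (PathIn.vmem x P ∧ ¬ PathIn.vmem y P) ∨ (¬ PathIn.vmem x P ∧ PathIn.vmem y P))

lemma Good.empty [Fintype V] (G : SimpleGraph V) : Good G ∅ ∅ := by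
  refine ⟨?_, ?_, ?_⟩ <;> simp

lemma Good.union [Fintype V] {G : SimpleGraph V} {A B : Finset V} {F H : Finset (PathIn G)}
    (hA : Good G A F) (hB : Good G B H) (hd : Disjoint A B)
    (hAl : ∀ x ∈ A, G.degree x = 1) (hBl : ∀ x ∈ B, G.degree x = 1) :
    Good G (A ∪ B) (F ∪ H) := by
  obtain ⟨a1, a2, a3⟩ := hA
  obtain ⟨b1, b2, b3⟩ := hB
  have hd' : ∀ x, x ∈ A → x ∈ B → False := fun x h1 h2 => (Finset.disjoint_left.1 hd) h1 h2
  refine ⟨?_, ?_, ?_⟩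
  · intro x hx
    rcases Finset.mem_union.1 hx with hx | hx
    · obtain ⟨P, hP, h⟩ := a1 x hx
      exact ⟨P, Finset.mem_union_left _ hP, h⟩
    · obtain ⟨P, hP, h⟩ := b1 x hx
      exact ⟨P, Finset.mem_union_right _ hP, h⟩
  · intro P hP x hx h
    rcases Finset.mem_union.1 hP with hP | hP
    · exact Finset.mem_union_left _ (a2 P hP x hx h)
    · exact Finset.mem_union_right _ (b2 P hP x hx h)
  · intro x hx y hy hne
    rcases Finset.mem_union.1 hx with hx | hx <;> rcases Finset.mem_union.1 hy with hy | hy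
    · obtain ⟨P, hP, h⟩ := a3 x hx y hy hne
      exact ⟨P, Finset.mem_union_left _ hP, h⟩
    · obtain ⟨P, hP, h⟩ := a1 x hx
      exact ⟨P, Finset.mem_union_left _ hP, Or.inl ⟨h, fun h' => hd' y (a2 P hP y (hBl y hy) h') hy⟩⟩
    · obtain ⟨P, hP, h⟩ := a1 y hy
      exact ⟨P, Finset.mem_union_left _ hP, Or.inr ⟨fun h' => hd' x (a2 P hP x (hBl x hx) h') hx, h⟩⟩
    · obtain ⟨P, hP, h⟩ := b3 x hx y hy hne
      exact ⟨P, Finset.mem_union_right _ hP, h⟩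

/-- The path between two vertices of a tree. -/
noncomputable def mkP {G : SimpleGraph V} (hT : G.IsTree) (a b : V) : PathIn G :=
  ⟨a, b, ⟨tp hT a b, tp_isPath hT a b⟩⟩

lemma vmem_mkP {G : SimpleGraph V} (hT : G.IsTree) {a b x : V} :
    PathIn.vmem x (mkP hT a b) ↔ x ∈ (tp hT a b).support := Iff.rfl

lemma leaf_mkP [Fintype V] {G : SimpleGraph V} (hT : G.IsTree) {a b x : V}
    (hx : G.degree x = 1) : PathIn.vmem x (mkP hT a b) ↔ x = a ∨ x = b := by
  rw [vmem_mkP]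
  constructor
  · exact leaf_end hT hx (tp_isPath hT a b)
  · rintro (rfl | rfl)
    · exact Walk.start_mem_support _
    · exact Walk.end_mem_support _

lemma Good.single [Fintype V] {G : SimpleGraph V} (hT : G.IsTree) {x : V}
    (hx : G.degree x = 1) : Good G {x} {mkP hT x x} := by
  refine ⟨?_, ?_, ?_⟩
  · simp [leaf_mkP hT hx]
  · intro P hP y hy h
    rw [Finset.mem_singleton.1 hP, leaf_mkP hT hy] at h
    simpa using h
  · intro a ha b hb hne
    rw [Finset.mem_singleton] at ha hb
    exact absurd (ha.trans hb.symm) hne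

lemma Good.triple [Fintype V] {G : SimpleGraph V} (hT : G.IsTree) {a b c : V}
    (ha : G.degree a = 1) (hb : G.degree b = 1) (hc : G.degree c = 1)
    (hab : a ≠ b) (hbc : b ≠ c) (hac : a ≠ c) :
    Good G {a, b, c} {mkP hT a b, mkP hT b c} := by
  have hl : ∀ x ∈ ({a, b, c} : Finset V), G.degree x = 1 := by
    intro x hx
    simp only [Finset.mem_insert, Finset.mem_singleton] at hx
    rcases hx with rfl | rfl | rfl <;> assumption
  refine ⟨?_, ?_, ?_⟩
  · intro x hx
    have := hl x hx
    simp only [Finset.mem_insert, Finset.mem_singleton, exists_eq_or_imp, exists_eq_left] at hx ⊢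
    rw [leaf_mkP hT this, leaf_mkP hT this]
    tauto
  · intro P hP y hy h
    simp only [Finset.mem_insert, Finset.mem_singleton] at hP ⊢
    rcases hP with rfl | rfl <;> rw [leaf_mkP hT hy] at h <;> tauto
  · intro x hx y hy hne
    have h1 := hl x hx
    have h2 := hl y hy
    simp only [Finset.mem_insert, Finset.mem_singleton, exists_eq_or_imp, exists_eq_left] at hx hy ⊢
    rw [leaf_mkP hT h1, leaf_mkP hT h1, leaf_mkP hT h2, leaf_mkP hT h2]
    rcases hx with rfl | rfl | rfl <;> rcases hy with rfl | rfl | rfl <;> grind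

lemma exists_good [Fintype V] {G : SimpleGraph V} (hT : G.IsTree) (n : ℕ) :
    ∀ A : Finset V, A.card = n → (∀ x ∈ A, G.degree x = 1) →
    ∃ F, Good G A F ∧ F.card ≤ (2 * n + 2) / 3 := by
  induction n using Nat.strong_induction_on with
  | _ n ih =>
    intro A hA hl
    by_cases h3 : 3 ≤ n
    · obtain ⟨B, hBA, hB⟩ := Finset.exists_subset_card_eq (hA ▸ h3 : 3 ≤ A.card)
      obtain ⟨a, b, c, hab, hac, hbc, rfl⟩ := Finset.card_eq_three.1 hB
      have hlB : ∀ x ∈ ({a, b, c} : Finset V), G.degree x = 1 := fun x hx => hl x (hBA hx)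
      obtain ⟨F, hF, hFc⟩ := ih (n - 3) (by omega) (A \ {a, b, c})
        (by rw [Finset.card_sdiff_of_subset hBA]; omega)
        (fun x hx => hl x (Finset.sdiff_subset hx))
      have hg := (Good.triple hT (hlB a (by simp)) (hlB b (by simp)) (hlB c (by simp)) hab hbc
        hac).union hF Finset.disjoint_sdiff hlB (fun x hx => hl x (Finset.sdiff_subset hx))
      rw [Finset.union_sdiff_of_subset hBA] at hg
      refine ⟨_, hg, (Finset.card_union_le _ _).trans ?_⟩
      have : ({mkP hT a b, mkP hT b c} : Finset (PathIn G)).card ≤ 2 := Finset.card_le_two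
      omega
    · by_cases h0 : n = 0
      · subst h0
        rw [Finset.card_eq_zero] at hA
        subst hA
        exact ⟨∅, Good.empty G, by simp⟩
      · obtain ⟨x, hx⟩ : A.Nonempty := Finset.card_pos.1 (by omega)
        obtain ⟨F, hF, hFc⟩ := ih (n - 1) (by omega) (A \ {x})
          (by rw [Finset.card_sdiff_of_subset (by simpa using hx)]; simp [hA])
          (fun x hx => hl x (Finset.sdiff_subset hx))
        have hg := (Good.single hT (hl x hx)).union hF Finset.disjoint_sdiff
          (by simpa using hl x hx) (fun x hx => hl x (Finset.sdiff_subset hx))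
        rw [Finset.union_sdiff_of_subset (by simpa using hx)] at hg
        refine ⟨_, hg, (Finset.card_union_le _ _).trans ?_⟩
        rw [Finset.card_singleton]
        have hn : n = 1 ∨ n = 2 := by omega
        rcases hn with rfl | rfl <;> omega

/-! ### Upper bound -/

lemma Good.biUnion [Fintype V] {G : SimpleGraph V} {ι : Type*} (A : ι → Finset V)
    (F : ι → Finset (PathIn G)) (hg : ∀ i, Good G (A i) (F i))
    (hd : ∀ i j, i ≠ j → Disjoint (A i) (A j)) (hl : ∀ i, ∀ x ∈ A i, G.degree x = 1)
    (T : Finset ι) : Good G (T.biUnion A) (T.biUnion F) := by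
  induction T using Finset.induction_on with
  | empty => simpa using Good.empty G
  | insert i T hi ih =>
    rw [Finset.biUnion_insert, Finset.biUnion_insert]
    refine (hg i).union ih ?_ (hl i) ?_
    · rw [Finset.disjoint_biUnion_right]
      intro j hj
      exact hd i j (fun h => hi (h ▸ hj))
    · intro x hx
      obtain ⟨j, _, hj⟩ := Finset.mem_biUnion.1 hx
      exact hl j x hj

lemma upper [Fintype V] {G : SimpleGraph V} (hT : G.IsTree) (S : Set V)
    (hS2 : 2 ≤ Fintype.card S)
    (hSmem : ∀ x s, G.degree x = 1 → G.Adj x s → s ∈ S)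
    (hSnl : ∀ s ∈ S, G.degree s ≠ 1)
    (h3 : ∀ s : S, ∃ a b c : V, a ≠ b ∧ b ≠ c ∧ a ≠ c ∧ (G.degree a = 1 ∧ G.Adj a s) ∧
      (G.degree b = 1 ∧ G.Adj b s) ∧ (G.degree c = 1 ∧ G.Adj c s))
    (hdeg : ∀ v, G.degree v ≠ 1 → 3 ≤ G.degree v) :
    ∃ F : Finset (PathIn G), VertexSep G (F : Set (PathIn G)) ∧
      VertexCover G (F : Set (PathIn G)) ∧ F.card ≤ (2 * leafCount G + 2) / 3 := by
  have hbr : ∀ v, (v ∉ S ∧ G.degree v ≠ 1) → ∀ u, G.Adj v u → ∃ s ∈ S, col hT v s = u := by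
    rintro v ⟨hvS, hv1⟩ u hu
    obtain ⟨x, hxv, hxu, hx1⟩ := branch_leaf hT hu
    have hs := hSmem x (col hT x v) hx1 (col_adj hT hxv.symm)
    refine ⟨_, hs, ?_⟩
    rw [← hxu]
    exact col_eq_of_adj hT (col_adj hT hxv.symm).symm (fun h => hvS (h ▸ hs)) hxv
  obtain ⟨σ, hσ, hσ2⟩ := exists_perm hT S hS2 (fun v => v ∉ S ∧ G.degree v ≠ 1)
    (fun v h => h.1) (fun v h => hdeg v h.2) hbr
  choose a b c hab hbc hac ha hb hc using h3
  -- leaves determine their centres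
  have hdet : ∀ (x : V) (s t : S), G.degree x = 1 → G.Adj x s → G.Adj x t → s = t :=
    fun x s t hx h1 h2 => Subtype.ext (leaf_unique hx h1 h2)
  let A : S → Finset V := fun s => {a s, b s, c (σ s)}
  let P : S → Finset (PathIn G) := fun s => {mkP hT (a s) (b s), mkP hT (b s) (c (σ s))}
  have hac' : ∀ s t, a s ≠ c t := by
    intro s t h
    have : s = t := hdet (a s) s t (ha s).1 (ha s).2 (h ▸ (hc t).2)
    subst this
    exact hac s h
  have hbc' : ∀ s t, b s ≠ c t := by
    intro s t h
    have : s = t := hdet (b s) s t (hb s).1 (hb s).2 (h ▸ (hc t).2)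
    subst this
    exact hbc s h
  have hab' : ∀ s t, a s ≠ b t := by
    intro s t h
    have : s = t := hdet (a s) s t (ha s).1 (ha s).2 (h ▸ (hb t).2)
    subst this
    exact hab s h
  have haa : ∀ s t, a s = a t → s = t := fun s t h =>
    hdet (a s) s t (ha s).1 (ha s).2 (h ▸ (ha t).2)
  have hbb : ∀ s t, b s = b t → s = t := fun s t h =>
    hdet (b s) s t (hb s).1 (hb s).2 (h ▸ (hb t).2)
  have hcc : ∀ s t, c s = c t → s = t := fun s t h =>
    hdet (c s) s t (hc s).1 (hc s).2 (h ▸ (hc t).2)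
  have hAl : ∀ s, ∀ x ∈ A s, G.degree x = 1 := by
    intro s x hx
    simp only [A, Finset.mem_insert, Finset.mem_singleton] at hx
    rcases hx with rfl | rfl | rfl
    exacts [(ha s).1, (hb s).1, (hc _).1]
  have hAP : ∀ s, Good G (A s) (P s) := fun s =>
    Good.triple hT (ha s).1 (hb s).1 (hc _).1 (hab s) (hbc' _ _) (hac' _ _)
  have hAd : ∀ s t, s ≠ t → Disjoint (A s) (A t) := by
    intro s t hst
    rw [Finset.disjoint_left]
    intro x hx hy
    simp only [A, Finset.mem_insert, Finset.mem_singleton] at hx hy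
    rcases hx with rfl | rfl | rfl <;> rcases hy with hy | hy | hy
    · exact hst (haa _ _ hy)
    · exact hab' _ _ hy
    · exact hac' _ _ hy
    · exact hab' _ _ hy.symm
    · exact hst (hbb _ _ hy)
    · exact hbc' _ _ hy
    · exact hac' _ _ hy.symm
    · exact hbc' _ _ hy.symm
    · exact hst (σ.injective (hcc _ _ hy))
  have hcore := Good.biUnion A P hAP hAd hAl Finset.univ
  have hAcard : (Finset.univ.biUnion A).card = 3 * Fintype.card S := by
    rw [Finset.card_biUnion (fun s _ t _ h => hAd s t h)]
    rw [Finset.sum_congr rfl (fun s _ => Finset.card_eq_three.2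
      ⟨a s, b s, c (σ s), hab s, hac' _ _, hbc' _ _, rfl⟩)]
    simp [mul_comm]
  have hPcard : (Finset.univ.biUnion P).card ≤ 2 * Fintype.card S := by
    have := Finset.card_biUnion_le_card_mul Finset.univ P 2 (fun s _ => Finset.card_le_two)
    rw [mul_comm]
    exact this
  let L : Finset V := Finset.univ.filter fun x => G.degree x = 1
  have hL : leafCount G = L.card := by
    simp [leafCount, L, Fintype.card_subtype]
  have hLm : ∀ x, x ∈ L ↔ G.degree x = 1 := fun x => by simp [L]
  have hAL : Finset.univ.biUnion A ⊆ L := by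
    intro x hx
    obtain ⟨s, _, hs⟩ := Finset.mem_biUnion.1 hx
    exact (hLm x).2 (hAl s x hs)
  obtain ⟨F', hF', hF'c⟩ := exists_good hT _ (L \ Finset.univ.biUnion A) rfl
    (fun x hx => (hLm x).1 (Finset.sdiff_subset hx))
  have hgood := hcore.union hF' Finset.disjoint_sdiff (fun x hx => (hLm x).1 (hAL hx))
    (fun x hx => (hLm x).1 (Finset.sdiff_subset hx))
  rw [Finset.union_sdiff_of_subset hAL] at hgood
  have hle := Finset.card_le_card hAL
  rw [Finset.card_sdiff_of_subset hAL] at hF'c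
  set F := Finset.univ.biUnion P ∪ F' with hF
  have hP1 : ∀ s, mkP hT (a s) (b s) ∈ F := fun s => Finset.mem_union_left _
    (Finset.mem_biUnion.2 ⟨s, Finset.mem_univ _, by simp [P]⟩)
  have hP2 : ∀ s, mkP hT (b s) (c (σ s)) ∈ F := fun s => Finset.mem_union_left _
    (Finset.mem_biUnion.2 ⟨s, Finset.mem_univ _, by simp [P]⟩)
  have key : ∀ v, G.degree v ≠ 1 → ∀ w, w ≠ v → ∃ R ∈ F, PathIn.vmem v R ∧ ¬ PathIn.vmem w R := by
    intro v hv w hw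
    by_cases hvS : v ∈ S
    · -- a bunch centre
      obtain ⟨t, ht⟩ := σ.surjective ⟨v, hvS⟩
      have hm1 : PathIn.vmem v (mkP hT (a ⟨v, hvS⟩) (b ⟨v, hvS⟩)) :=
        leaf_nbr_mem hT (ha _).1 (ha _).2 (hab _).symm
      have hm2 : PathIn.vmem v (mkP hT (b t) (c (σ t))) := by
        rw [vmem_mkP, mem_tp_comm]
        refine leaf_nbr_mem hT (hc _).1 ?_ (hbc' _ _)
        rw [ht]
        exact (hc ⟨v, hvS⟩).2
      by_cases hwm : PathIn.vmem w (mkP hT (a ⟨v, hvS⟩) (b ⟨v, hvS⟩))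
      · refine ⟨_, hP2 t, hm2, fun hwm2 => ?_⟩
        have hw' : w = a ⟨v, hvS⟩ ∨ w = b ⟨v, hvS⟩ := by
          rw [vmem_mkP] at hwm hm1
          rw [path_split hT (tp_isPath hT _ _) hm1, Walk.mem_support_append_iff,
            tp_adj hT (ha ⟨v, hvS⟩).2, tp_adj hT (hb ⟨v, hvS⟩).2.symm] at hwm
          simp at hwm
          tauto
        rcases hw' with rfl | rfl
        · rw [leaf_mkP hT (ha _).1] at hwm2
          rcases hwm2 with h | h
          · exact hab' _ _ h
          · exact hac' _ _ h
        · rw [leaf_mkP hT (hb _).1] at hwm2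
          rcases hwm2 with h | h
          · have := hbb _ _ h
            rw [← ht] at this
            exact hσ t this
          · exact hbc' _ _ h
      · exact ⟨_, hP1 _, hm1, hwm⟩
    · -- an interior vertex without leaf neighbours
      obtain ⟨s, hs1, hs2, hs3⟩ := hσ2 v ⟨hvS, hv⟩ (col hT v w) (col_adj hT hw)
      have hne : ∀ s ∈ S, s ≠ v := fun s hs h => hvS (h ▸ hs)
      have hbv : col hT v (b s) = col hT v s :=
        col_eq_of_adj hT (hb s).2 (fun h => hv (h ▸ (hb s).1)) (hne _ s.2)
      have hcv : col hT v (c (σ s)) = col hT v (σ s) :=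
        col_eq_of_adj hT (hc (σ s)).2 (fun h => hv (h ▸ (hc (σ s)).1)) (hne _ (σ s).2)
      have hm : v ∈ (tp hT (b s) (c (σ s))).support :=
        mem_of_col_ne hT (by rw [hbv, hcv]; exact hs3)
      refine ⟨_, hP2 s, hm, fun hwm => ?_⟩
      have hu := tp_subset hT (tp_isPath hT _ _) hm hwm (col_mem hT v w)
      rcases nbr_mem hT hm (col_adj hT hw) hu with h | h
      · exact hs1 (by rw [← hbv, h])
      · exact hs2 (by rw [← hcv, h])
  refine ⟨F, ?_, ?_, ?_⟩
  · intro x y hxy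
    by_cases hx : G.degree x = 1
    · by_cases hy : G.degree y = 1
      · obtain ⟨R, hR, h⟩ := hgood.2.2 x ((hLm x).2 hx) y ((hLm y).2 hy) hxy
        exact ⟨R, hR, h⟩
      · obtain ⟨R, hR, h1, h2⟩ := key y hy x hxy
        exact ⟨R, hR, Or.inr ⟨h2, h1⟩⟩
    · obtain ⟨R, hR, h1, h2⟩ := key x hx y hxy.symm
      exact ⟨R, hR, Or.inl ⟨h1, h2⟩⟩
  · intro x
    by_cases hx : G.degree x = 1
    · obtain ⟨R, hR, h⟩ := hgood.1 x ((hLm x).2 hx)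
      exact ⟨R, hR, h⟩
    · have : 0 < G.degree x := by have := hdeg x hx; omega
      obtain ⟨w, hw⟩ := (G.degree_pos_iff_exists_adj x).1 this
      obtain ⟨R, hR, h, _⟩ := key x hx w hw.ne'
      exact ⟨R, hR, h⟩
  · have := Finset.card_union_le (Finset.univ.biUnion P) F'
    rw [← hF] at this
    rw [hL]
    omega

/-! ### Bunches -/

lemma H_adj [Fintype V] (G : SimpleGraph V) {x y : V} :
    (G.deleteEdges (interiorEdgeSet G)).Adj x y ↔
      G.Adj x y ∧ (G.degree x = 1 ∨ G.degree y = 1) := by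
  rw [deleteEdges_adj]
  simp only [interiorEdgeSet, Set.mem_setOf_eq, mem_edgeSet, Sym2.mem_iff, forall_eq_or_imp,
    forall_eq]
  tauto

lemma H_closed [Fintype V] (G : SimpleGraph V) (C : V → Prop)
    (hC : ∀ x y, (G.deleteEdges (interiorEdgeSet G)).Adj x y → C x → C y) {x y : V}
    (h : (G.deleteEdges (interiorEdgeSet G)).connectedComponentMk x =
      (G.deleteEdges (interiorEdgeSet G)).connectedComponentMk y) (hx : C x) : C y := by
  obtain ⟨p⟩ := ConnectedComponent.exact h
  induction p with
  | nil => exact hx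
  | cons hadj p ih => exact ih (ConnectedComponent.sound ⟨p⟩) (hC _ _ hadj hx)

end TreeSep

set_option maxHeartbeats 2000000 in
theorem stmt15 [Fintype V] (G : SimpleGraph V) (hT : G.IsTree)
    (hdeg : ∀ v : V, G.degree v ≠ 2)
    (hbunches : 2 ≤ Nat.card {C : (G.deleteEdges (interiorEdgeSet G)).ConnectedComponent |
      ∃ x y : V, x ≠ y ∧
        (G.deleteEdges (interiorEdgeSet G)).connectedComponentMk x = C ∧
        (G.deleteEdges (interiorEdgeSet G)).connectedComponentMk y = C})
    (hsize : ∀ C : (G.deleteEdges (interiorEdgeSet G)).ConnectedComponent,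
      (∃ x y : V, x ≠ y ∧
        (G.deleteEdges (interiorEdgeSet G)).connectedComponentMk x = C ∧
        (G.deleteEdges (interiorEdgeSet G)).connectedComponentMk y = C) →
      3 ≤ Nat.card {v : V |
        (G.deleteEdges (interiorEdgeSet G)).connectedComponentMk v = C ∧ G.degree v = 1}) :
    IsLeast {n : ℕ | ∃ F : Set (PathIn G),
        F.Finite ∧ VertexSep G F ∧ VertexCover G F ∧ F.ncard = n}
      ((2 * leafCount G + 2) / 3) := by
  let H := G.deleteEdges (interiorEdgeSet G)
  have hHadj : ∀ {x y : V}, H.Adj x y ↔ G.Adj x y ∧ (G.degree x = 1 ∨ G.degree y = 1) :=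
    TreeSep.H_adj G
  have hmk : ∀ {x y : V}, H.Adj x y → H.connectedComponentMk x = H.connectedComponentMk y :=
    fun h => ConnectedComponent.sound h.reachable
  -- a leaf is not adjacent to a leaf
  have hnoK2 : ∀ x y, G.degree x = 1 → G.Adj x y → G.degree y ≠ 1 := by
    intro x y hx hxy hy
    have h3 := hsize (H.connectedComponentMk x) ⟨x, y, hxy.ne, rfl,
      (hmk (hHadj.2 ⟨hxy, Or.inl hx⟩)).symm⟩
    have hsub : {v : V | H.connectedComponentMk v = H.connectedComponentMk x ∧ G.degree v = 1} ⊆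
        ({x, y} : Set V) := by
      intro v hv
      have := TreeSep.H_closed G (fun v => v = x ∨ v = y) (by
        rintro p q hpq (rfl | rfl)
        · exact Or.inr (TreeSep.leaf_unique hx (TreeSep.H_adj G |>.1 hpq).1 hxy)
        · exact Or.inl (TreeSep.leaf_unique hy (TreeSep.H_adj G |>.1 hpq).1 hxy.symm))
        hv.1.symm (Or.inl rfl)
      simpa using this
    have h4 := Set.ncard_le_ncard hsub (Set.toFinite _)
    have h5 := Set.ncard_pair hxy.ne
    rw [h5] at h4
    have : 3 ≤ Set.ncard {v : V | H.connectedComponentMk v = H.connectedComponentMk x ∧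
      G.degree v = 1} := h3
    omega
  let S : Set V := {s | G.degree s ≠ 1 ∧ ∃ x, G.degree x = 1 ∧ G.Adj x s}
  have h3 : ∀ s : S, ∃ a b c : V, a ≠ b ∧ b ≠ c ∧ a ≠ c ∧ (G.degree a = 1 ∧ G.Adj a s) ∧
      (G.degree b = 1 ∧ G.Adj b s) ∧ (G.degree c = 1 ∧ G.Adj c s) := by
    rintro ⟨s, hs, x, hx, hxs⟩
    have h3 : 3 ≤ Set.ncard {v : V | H.connectedComponentMk v = H.connectedComponentMk s ∧
        G.degree v = 1} := hsize (H.connectedComponentMk s) ⟨s, x, hxs.ne', rfl,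
          hmk (hHadj.2 ⟨hxs, Or.inl hx⟩)⟩
    have hall : ∀ v, H.connectedComponentMk v = H.connectedComponentMk s → G.degree v = 1 →
        G.degree v = 1 ∧ G.Adj v s := by
      intro v hv hv1
      have := TreeSep.H_closed G (fun v => v = s ∨ (G.degree v = 1 ∧ G.Adj v s)) (by
        rintro p q hpq (rfl | ⟨h1, h2⟩)
        · have := (TreeSep.H_adj G).1 hpq
          exact Or.inr ⟨this.2.resolve_left hs, this.1.symm⟩
        · exact Or.inl (TreeSep.leaf_unique h1 (TreeSep.H_adj G |>.1 hpq).1 h2))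
        hv.symm (Or.inl rfl)
      rcases this with rfl | h
      · exact absurd hv1 hs
      · exact h
    obtain ⟨a, b, c, ha, hb, hc, hab, hac, hbc⟩ := (Set.two_lt_ncard_iff (Set.toFinite _)).1 h3
    exact ⟨a, b, c, hab, hbc, hac, hall a ha.1 ha.2, hall b hb.1 hb.2, hall c hc.1 hc.2⟩
  have hcomp : ∀ C : H.ConnectedComponent, (∃ x y : V, x ≠ y ∧ H.connectedComponentMk x = C ∧
      H.connectedComponentMk y = C) → ∃ s ∈ S, H.connectedComponentMk s = C := by
    rintro C ⟨x, y, hxy, hx, hy⟩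
    obtain ⟨p⟩ := ConnectedComponent.exact (hx.trans hy.symm)
    cases p with
    | nil => exact absurd rfl hxy
    | @cons _ z _ hadj p =>
      obtain ⟨hG, h | h⟩ := hHadj.1 hadj
      · exact ⟨z, ⟨hnoK2 x z h hG, x, h, hG⟩, by rw [← hmk hadj, hx]⟩
      · exact ⟨x, ⟨hnoK2 z x h hG.symm, z, h, hG.symm⟩, hx⟩
  have hS2 : 2 ≤ Fintype.card S := by
    have hb : 1 < Set.ncard {C : H.ConnectedComponent |
      ∃ x y : V, x ≠ y ∧ H.connectedComponentMk x = C ∧ H.connectedComponentMk y = C} := hbunches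
    obtain ⟨C, D, hC, hD, hCD⟩ := (Set.one_lt_ncard_iff (Set.toFinite _)).1 hb
    obtain ⟨s, hs, hsC⟩ := hcomp C hC
    obtain ⟨t, ht, htD⟩ := hcomp D hD
    have : (⟨s, hs⟩ : S) ≠ ⟨t, ht⟩ := by
      intro h
      have : s = t := congrArg Subtype.val h
      exact hCD (by rw [← hsC, ← htD, this])
    exact Fintype.one_lt_card_iff.2 ⟨_, _, this⟩
  have hdeg3 : ∀ v, G.degree v ≠ 1 → 3 ≤ G.degree v := by
    intro v hv
    have h2 := hdeg v
    have h0 : 0 < G.degree v := by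
      obtain ⟨s, t, hst⟩ := Fintype.one_lt_card_iff.1 hS2
      haveI : Nontrivial V := ⟨s, t, fun h => hst (Subtype.ext h)⟩
      exact hT.connected.preconnected.degree_pos_of_nontrivial v
    omega
  obtain ⟨F, hF1, hF2, hF3⟩ := TreeSep.upper hT S (by convert hS2)
    (fun x s hx hxs => ⟨hnoK2 x s hx hxs, x, hx, hxs⟩) (fun s hs => hs.1) h3 hdeg3
  constructor
  · refine ⟨F, F.finite_toSet, hF1, hF2, ?_⟩
    rw [Set.ncard_coe_finset]
    exact le_antisymm hF3 (TreeSep.lower hT F hF1 hF2)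
  · rintro n ⟨F', hfin, h1, h2, rfl⟩
    have := TreeSep.lower hT hfin.toFinset (by simpa using h1) (by simpa using h2)
    rwa [← Set.ncard_eq_toFinset_card F' hfin] at this
end
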